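/- arXiv:0801.1371 — 8 statements merged into one kernel-verified Lean document; each statement's English description precedes it below -/
import Mathlib

section
/- Let X be an mm-space with total mass m = μ_X(X) and let 0 < κ' < κ. Then Sep(X; κ, κ) ≤ ObsDiam_ℝ(X; −κ'). -/
open MeasureTheory ENNReal

/-- The distance between two subsets of an (extended) metric space. -/
noncomputable def setSep {α : Type*} [PseudoEMetricSpace α] (A B : Set α) : ℝ≥0∞ :=
  ⨅ x ∈ A, EMetric.infEdist x B

/-- The separation distance `Sep(μ; κ₁, κ₂)`: the supremum of the distances `d(A,B)` over
Borel sets `A`, `B` with `μ A ≥ κ₁` and `μ B ≥ κ₂`. -/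
noncomputable def sep {α : Type*} [PseudoEMetricSpace α] [MeasurableSpace α]
    (μ : Measure α) (κ₁ κ₂ : ℝ≥0∞) : ℝ≥0∞ :=
  ⨆ (A : Set α) (B : Set α) (_ : MeasurableSet A) (_ : MeasurableSet B)
    (_ : κ₁ ≤ μ A) (_ : κ₂ ≤ μ B), setSep A B

/-- The partial diameter `diam(ν, a)`: the infimum of diameters of Borel sets of measure `≥ a`. -/
noncomputable def partialDiam {α : Type*} [PseudoEMetricSpace α] [MeasurableSpace α]
    (ν : Measure α) (a : ℝ≥0∞) : ℝ≥0∞ :=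
  ⨅ (s : Set α) (_ : MeasurableSet s) (_ : a ≤ ν s), EMetric.diam s

/-- The observable diameter `ObsDiam_Y(X; -κ)`. -/
noncomputable def obsDiam (Y : Type*) [MetricSpace Y] [MeasurableSpace Y]
    {X : Type*} [MetricSpace X] [MeasurableSpace X] (μ : Measure X) (κ : ℝ≥0∞) : ℝ≥0∞ :=
  ⨆ (f : X → Y) (_ : LipschitzWith 1 f), partialDiam (Measure.map f μ) (μ Set.univ - κ)

/-- `V_p(ν) = (∬ d(x,y)^p dν dν)^{1/p}`. -/
noncomputable def varP {α : Type*} [PseudoEMetricSpace α] [MeasurableSpace α]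
    (ν : Measure α) (p : ℝ) : ℝ≥0∞ :=
  (∫⁻ x, ∫⁻ y, edist x y ^ p ∂ν ∂ν) ^ (1 / p)

/-- The observable `L^p`-variation `ObsL^pVar_Y(X)`. -/
noncomputable def obsVar (Y : Type*) [MetricSpace Y] [MeasurableSpace Y]
    {X : Type*} [MetricSpace X] [MeasurableSpace X] (μ : Measure X) (p : ℝ) : ℝ≥0∞ :=
  ⨆ (f : X → Y) (_ : LipschitzWith 1 f), varP (Measure.map f μ) p

/-- The central radius: the infimum of `ρ > 0` such that the closed ball of radius `ρ`
around `c` has measure at least `a`. -/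
noncomputable def cRad {α : Type*} [PseudoEMetricSpace α] [MeasurableSpace α]
    (ν : Measure α) (c : α) (a : ℝ≥0∞) : ℝ≥0∞ :=
  sInf {ρ : ℝ≥0∞ | 0 < ρ ∧ a ≤ ν (EMetric.closedBall c ρ)}

/-- `z₀` is the center of mass of `ν`: for every `z`, `z₀` is the unique minimizer of
`x ↦ ∫ (d(x,y)² - d(z,y)²) dν(y)`. -/
def IsCenterOfMass {α : Type*} [MetricSpace α] [MeasurableSpace α]
    (ν : Measure α) (z₀ : α) : Prop :=
  ∀ z x : α, x ≠ z₀ →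
    (∫ y, (dist z₀ y ^ 2 - dist z y ^ 2) ∂ν) < ∫ y, (dist x y ^ 2 - dist z y ^ 2) ∂ν

/-- `ν` has a finite first moment: `∫ d(x,y) dν(y) < ∞` for some `x`. -/
def FiniteFirstMoment {α : Type*} [MetricSpace α] [MeasurableSpace α] (ν : Measure α) : Prop :=
  ∃ x : α, (∫⁻ y, edist x y ∂ν) < ⊤

/-- `ν` has separable support. -/
def HasSeparableSupport {α : Type*} [MetricSpace α] [MeasurableSpace α] (ν : Measure α) : Prop :=
  ∃ s : Set α, TopologicalSpace.IsSeparable s ∧ ν sᶜ = 0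

/-- `γ` (restricted to `[0, d(z,w)]`) is a geodesic from `z` to `w`, i.e. an isometric
embedding of the interval `[0, d(z,w)]` sending the endpoints to `z` and `w`. -/
def IsGeodesic {T : Type*} [MetricSpace T] (z w : T) (γ : ℝ → T) : Prop :=
  γ 0 = z ∧ γ (dist z w) = w ∧
    ∀ s ∈ Set.Icc (0 : ℝ) (dist z w), ∀ t ∈ Set.Icc (0 : ℝ) (dist z w),
      dist (γ s) (γ t) = |s - t|

/-- An `ℝ`-tree: a complete geodesic metric space which is `0`-hyperbolic. -/
def IsRTree (T : Type*) [MetricSpace T] : Prop :=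
  CompleteSpace T ∧ (∀ z w : T, ∃ γ : ℝ → T, IsGeodesic z w γ) ∧
    ∀ x y z w : T, dist x y + dist z w ≤ max (dist x z + dist y w) (dist x w + dist y z)

/-- A set is (geodesically) convex if every geodesic joining two of its points stays in it. -/
def GeodConvex {T : Type*} [MetricSpace T] (s : Set T) : Prop :=
  ∀ z ∈ s, ∀ w ∈ s, ∀ γ : ℝ → T, IsGeodesic z w γ →
    γ '' Set.Icc (0 : ℝ) (dist z w) ⊆ s

/-- `z` is a median of `ν`: there are closed convex `T'`, `T''` covering the space with
`T' ∩ T'' = {z}` and both of measure at least `ν(univ)/3`. -/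
def IsMedian {T : Type*} [MetricSpace T] [MeasurableSpace T] (ν : Measure T) (z : T) : Prop :=
  ∃ T' T'' : Set T, IsClosed T' ∧ IsClosed T'' ∧ GeodConvex T' ∧ GeodConvex T'' ∧
    T' ∪ T'' = Set.univ ∧ T' ∩ T'' = {z} ∧
    ν Set.univ / 3 ≤ ν T' ∧ ν Set.univ / 3 ≤ ν T''

/-- The observable central radius `ObsCRad_Y(X; -κ)`, the supremum of the central radii of
push-forwards under `1`-Lipschitz maps (taken at their centers of mass). -/
noncomputable def obsCRad (Y : Type*) [MetricSpace Y] [MeasurableSpace Y]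
    {X : Type*} [MetricSpace X] [MeasurableSpace X] (μ : Measure X) (κ : ℝ≥0∞) : ℝ≥0∞ :=
  ⨆ (f : X → Y) (_ : LipschitzWith 1 f) (c : Y) (_ : IsCenterOfMass (Measure.map f μ) c),
    cRad (Measure.map f μ) c (μ Set.univ - κ)

/-- The separation of two sets is at most the distance from any point of the second
set to the first set. -/
theorem setSep_le_infEDist {α : Type*} [PseudoEMetricSpace α] {A B : Set α} {b : α}
    (hb : b ∈ B) : setSep A B ≤ Metric.infEDist b A := by
  refine Metric.le_infEDist.2 fun a ha => ?_
  rw [edist_comm]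
  exact (iInf₂_le a ha).trans (Metric.infEDist_le_edist_of_mem hb)

/-- In a finite measure space, a set of measure at least `μ univ - κ'` meets every measurable
set of measure larger than `κ'`. -/
theorem inter_nonempty_of_measure_univ_sub_le {α : Type*} [MeasurableSpace α] {μ : Measure α}
    [IsFiniteMeasure μ] {κ' : ℝ≥0∞} {A s : Set α} (hA : MeasurableSet A) (hκA : κ' < μ A)
    (hs : μ Set.univ - κ' ≤ μ s) : (A ∩ s).Nonempty := by
  by_contra h
  have hdisj : Disjoint A s := Set.disjoint_iff_inter_eq_empty.2 (Set.not_nonempty_iff_eq_empty.1 h)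
  have hcompl : μ s ≤ μ Set.univ - μ A := by
    rw [← measure_compl hA (measure_ne_top μ A)]
    exact measure_mono hdisj.subset_compl_left
  have hle : μ A ≤ κ' :=
    (ENNReal.sub_le_sub_iff_left (measure_mono (Set.subset_univ A)) (measure_ne_top μ _)).1
      (hs.trans hcompl)
  exact hκA.not_ge hle

/-- For an mm-space `X` and `0 < κ' < κ`,
`Sep(X; κ, κ) ≤ ObsDiam_ℝ(X; -κ')`. -/
theorem sep_le_obsDiam_real {X : Type*} [MetricSpace X] [CompleteSpace X]
    [TopologicalSpace.SeparableSpace X] [MeasurableSpace X] [BorelSpace X]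
    (μ : Measure X) [IsFiniteMeasure μ]
    (κ κ' : ℝ≥0∞) (hκ'0 : 0 < κ') (hκ'κ : κ' < κ) (hκ : κ ≠ ⊤) :
    sep μ κ κ ≤ obsDiam ℝ μ κ' := by
  refine iSup_le fun A => iSup_le fun B => iSup_le fun hA => iSup_le fun hB =>
    iSup_le fun hκA => iSup_le fun hκB => ?_
  have hf : LipschitzWith 1 fun x => Metric.infDist x A := Metric.lipschitz_infDist_pt A
  refine le_iSup₂_of_le (fun x => Metric.infDist x A) hf ?_
  refine le_iInf fun s => le_iInf fun hs => le_iInf fun hκs => ?_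
  rw [Measure.map_apply hf.continuous.measurable hs] at hκs
  obtain ⟨a, haA, has⟩ := inter_nonempty_of_measure_univ_sub_le hA (hκ'κ.trans_le hκA) hκs
  obtain ⟨b, hbB, hbs⟩ := inter_nonempty_of_measure_univ_sub_le hB (hκ'κ.trans_le hκB) hκs
  calc setSep A B ≤ Metric.infEDist b A := setSep_le_infEDist hbB
    _ = edist (Metric.infDist b A) (Metric.infDist a A) := by
        rw [Metric.infDist_zero_of_mem haA, edist_dist, Real.dist_0_eq_abs,
          abs_of_nonneg Metric.infDist_nonneg, Metric.infDist,
          ENNReal.ofReal_toReal (Metric.infEDist_ne_top ⟨a, haA⟩)]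
    _ ≤ Metric.ediam s := Metric.edist_le_ediam_of_mem hbs has
end

section
/- Let X be an mm-space. Then for any κ > 0, ObsDiam_ℝ(X; −2κ) ≤ Sep(X; κ, κ). -/
open MeasureTheory ENNReal

/-- A finite measure on `ℝ` of mass more than `κ > 0` has a quantile at level `κ`. -/
theorem exists_le_measure_Iic_and_measure_Iio_le (ν : Measure ℝ) [IsFiniteMeasure ν] {κ : ℝ≥0∞}
    (hκ0 : 0 < κ) (hκ : κ < ν Set.univ) :
    ∃ a : ℝ, κ ≤ ν (Set.Iic a) ∧ ν (Set.Iio a) ≤ κ := by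
  set S : Set ℝ := {t | κ ≤ ν (Set.Iic t)}
  have hne : S.Nonempty := by
    obtain ⟨t, ht⟩ := ((tendsto_measure_Iic_atTop ν).eventually_const_lt hκ).exists
    exact ⟨t, ht.le⟩
  have hbdd : BddBelow S := by
    have hlim := tendsto_measure_iInter_atTop (μ := ν) (s := fun x : ℝ => Set.Iic (-x))
      (fun _ => measurableSet_Iic.nullMeasurableSet)
      (fun x y hxy => Set.Iic_subset_Iic.2 (neg_le_neg hxy)) ⟨0, measure_ne_top _ _⟩
    have hempty : ⋂ x : ℝ, Set.Iic (-x) = ∅ := by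
      refine Set.eq_empty_of_forall_notMem fun y hy => ?_
      have := Set.mem_iInter.1 hy (1 - y)
      simp only [Set.mem_Iic] at this
      linarith
    rw [hempty, measure_empty] at hlim
    obtain ⟨t, ht⟩ := (hlim.eventually_lt_const hκ0).exists
    refine ⟨-t, fun x hx => le_of_not_gt fun hxt => ?_⟩
    exact (hx.trans (measure_mono (Set.Iic_subset_Iic.2 hxt.le))).not_gt ht
  refine ⟨sInf S, ?_, ?_⟩
  · have hlim := tendsto_measure_biInter_gt (μ := ν) (s := fun x : ℝ => Set.Iic x) (a := sInf S)
      (fun _ _ => measurableSet_Iic.nullMeasurableSet)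
      (fun _ _ _ hij => Set.Iic_subset_Iic.2 hij)
      ⟨sInf S + 1, by simp, measure_ne_top _ _⟩
    have hinter : ⋂ r > sInf S, Set.Iic r = Set.Iic (sInf S) := by
      ext x
      simp [forall_gt_imp_ge_iff_le_of_dense]
    rw [hinter] at hlim
    refine ge_of_tendsto hlim ?_
    filter_upwards [self_mem_nhdsWithin] with r hr
    obtain ⟨t, ht, htr⟩ := exists_lt_of_csInf_lt hne hr
    exact le_trans ht (measure_mono (Set.Iic_subset_Iic.2 htr.le))
  · obtain ⟨u, hu, hlt, hlim⟩ := exists_seq_strictMono_tendsto (sInf S)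
    rw [← iUnion_Iic_eq_Iio_of_lt_of_tendsto hlt hlim]
    refine le_of_tendsto (tendsto_measure_iUnion_atTop (μ := ν)
      fun m n hmn => Set.Iic_subset_Iic.2 (hu.monotone hmn)) (.of_forall fun n => ?_)
    exact (not_le.1 fun h => (csInf_le hbdd h).not_gt (hlt n)).le

/-- The upper-tail version of `exists_le_measure_Iic_and_measure_Iio_le`. -/
theorem exists_le_measure_Ici_and_measure_Ioi_le (ν : Measure ℝ) [IsFiniteMeasure ν] {κ : ℝ≥0∞}
    (hκ0 : 0 < κ) (hκ : κ < ν Set.univ) :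
    ∃ b : ℝ, κ ≤ ν (Set.Ici b) ∧ ν (Set.Ioi b) ≤ κ := by
  obtain ⟨a, h₁, h₂⟩ := exists_le_measure_Iic_and_measure_Iio_le (ν.map Neg.neg) hκ0
    (by rwa [Measure.map_apply measurable_neg .univ])
  rw [Measure.map_apply measurable_neg measurableSet_Iic] at h₁
  rw [Measure.map_apply measurable_neg measurableSet_Iio] at h₂
  exact ⟨-a, by simpa using h₁, by simpa using h₂⟩

/-- Preimages of opposite half-lines under a `1`-Lipschitz function are at least as far apart
as the half-lines themselves. -/
theorem ofReal_sub_le_setSep_preimage {X : Type*} [PseudoEMetricSpace X] {f : X → ℝ}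
    (hf : LipschitzWith 1 f) (a b : ℝ) :
    ENNReal.ofReal (b - a) ≤ setSep (f ⁻¹' Set.Iic a) (f ⁻¹' Set.Ici b) := by
  refine le_iInf₂ fun x hx => Metric.le_infEDist.2 fun y hy => ?_
  have hxy : b - a ≤ dist (f x) (f y) := by
    rw [dist_comm, Real.dist_eq]
    exact (sub_le_sub hy hx).trans (le_abs_self _)
  calc ENNReal.ofReal (b - a) ≤ edist (f x) (f y) := by
        rw [edist_dist]; exact ENNReal.ofReal_le_ofReal hxy
    _ ≤ edist x y := by simpa using hf x y

/-- For an mm-space `X` and any `κ > 0`,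
`ObsDiam_ℝ(X; -2κ) ≤ Sep(X; κ, κ)`. -/
theorem obsDiam_real_le_sep {X : Type*} [MetricSpace X] [CompleteSpace X]
    [TopologicalSpace.SeparableSpace X] [MeasurableSpace X] [BorelSpace X]
    (μ : Measure X) [IsFiniteMeasure μ]
    (κ : ℝ≥0∞) (hκ0 : 0 < κ) (hκ : κ ≠ ⊤) :
    obsDiam ℝ μ (2 * κ) ≤ sep μ κ κ := by
  refine iSup₂_le fun f hf => ?_
  have hfm : Measurable f := hf.continuous.measurable
  set ν := μ.map f
  have hν : ν Set.univ = μ Set.univ := by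
    rw [Measure.map_apply hfm .univ, Set.preimage_univ]
  rcases le_or_gt (μ Set.univ) (2 * κ) with hle | hlt
  · refine (iInf₂_le_of_le ∅ .empty (iInf_le_of_le ?_ ?_) : partialDiam ν _ ≤ 0).trans zero_le
    · simp [tsub_eq_zero_of_le hle]
    · exact Metric.ediam_empty.le
  have hκν : κ < ν Set.univ := by
    rw [hν]
    exact lt_of_le_of_lt (by rw [two_mul]; exact le_self_add) hlt
  obtain ⟨a, ha, ha'⟩ := exists_le_measure_Iic_and_measure_Iio_le ν hκ0 hκν
  obtain ⟨b, hb, hb'⟩ := exists_le_measure_Ici_and_measure_Ioi_le ν hκ0 hκν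
  have hIcc : μ Set.univ - 2 * κ ≤ ν (Set.Icc a b) := by
    rw [tsub_le_iff_right, ← hν]
    have hcover : Set.univ ⊆ Set.Icc a b ∪ (Set.Iio a ∪ Set.Ioi b) := by
      intro x _
      simp only [Set.mem_union, Set.mem_Icc, Set.mem_Iio, Set.mem_Ioi]
      grind
    calc ν Set.univ ≤ ν (Set.Icc a b) + (ν (Set.Iio a) + ν (Set.Ioi b)) :=
          (measure_mono hcover).trans ((measure_union_le _ _).trans
            (by gcongr; exact measure_union_le _ _))
      _ ≤ ν (Set.Icc a b) + 2 * κ := by rw [two_mul]; gcongr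
  rw [Measure.map_apply hfm measurableSet_Iic] at ha
  rw [Measure.map_apply hfm measurableSet_Ici] at hb
  calc partialDiam ν (μ Set.univ - 2 * κ) ≤ Metric.ediam (Set.Icc a b) :=
        iInf₂_le_of_le _ measurableSet_Icc (iInf_le _ hIcc)
    _ = ENNReal.ofReal (b - a) := Real.ediam_Icc a b
    _ ≤ setSep (f ⁻¹' Set.Iic a) (f ⁻¹' Set.Ici b) := ofReal_sub_le_setSep_preimage hf a b
    _ ≤ sep μ κ κ :=
        le_iSup₂_of_le _ _ <| le_iSup₂_of_le (hfm measurableSet_Iic) (hfm measurableSet_Ici) <|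
          le_iSup₂_of_le ha hb le_rfl
end

section
/- Let X be an mm-space with total mass m = μ_X(X) > 0. Then for any p ≥ 1 and κ > 0, Sep(X; κ, κ) ≤ 2(mκ)^{−1/p} · ObsL^pVar_ℝ(X) (where both sides may take the value +∞). -/
open MeasureTheory ENNReal

theorem setSep_le_edist {α : Type*} [PseudoEMetricSpace α] {A B : Set α} {a b : α}
    (ha : a ∈ A) (hb : b ∈ B) : setSep A B ≤ edist a b :=
  (iInf₂_le a ha).trans (Metric.infEDist_le_edist_of_mem hb)

/-- Two sets of measure at least `κ` at distance at least `s` bound `V_p` from below: every point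
has distance at least `s / 2` to all points of one of the two sets. -/
theorem mul_half_le_varP {α : Type*} [PseudoEMetricSpace α] [MeasurableSpace α]
    (ν : Measure α) {p : ℝ} (hp : 0 < p) {κ s : ℝ≥0∞} {A B : Set α}
    (hA : MeasurableSet A) (hB : MeasurableSet B) (hκA : κ ≤ ν A) (hκB : κ ≤ ν B)
    (hs : ∀ a ∈ A, ∀ b ∈ B, s ≤ edist a b) :
    (ν Set.univ * κ) ^ (1 / p) * (s / 2) ≤ varP ν p := by
  have lower_bound : ∀ (C : Set α) (x : α), MeasurableSet C → κ ≤ ν C →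
      (∀ c ∈ C, s / 2 ≤ edist x c) → (s / 2) ^ p * κ ≤ ∫⁻ y, edist x y ^ p ∂ν := by
    intro C x hC hκC h
    calc (s / 2) ^ p * κ ≤ (s / 2) ^ p * ν C := by gcongr
      _ = ∫⁻ _ in C, (s / 2) ^ p ∂ν := (setLIntegral_const _ _).symm
      _ ≤ ∫⁻ y in C, edist x y ^ p ∂ν :=
        setLIntegral_mono' hC fun y hy => ENNReal.rpow_le_rpow (h y hy) hp.le
      _ ≤ ∫⁻ y, edist x y ^ p ∂ν := setLIntegral_le_lintegral _ _
  have inner_bound : ∀ x, (s / 2) ^ p * κ ≤ ∫⁻ y, edist x y ^ p ∂ν := by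
    intro x
    by_cases h : ∀ a ∈ A, s / 2 ≤ edist x a
    · exact lower_bound A x hA hκA h
    · push Not at h
      obtain ⟨a, ha, hxa⟩ := h
      refine lower_bound B x hB hκB fun b hb => ?_
      by_contra! hxb
      have hlt : edist x a + edist x b < s := by
        simpa only [ENNReal.add_halves] using ENNReal.add_lt_add hxa hxb
      exact (hs a ha b hb).not_gt ((edist_triangle_left a b x).trans_lt hlt)
  calc (ν Set.univ * κ) ^ (1 / p) * (s / 2)
      = ((s / 2) ^ p * κ * ν Set.univ) ^ (1 / p) := by
        rw [mul_assoc, ENNReal.mul_rpow_of_nonneg ((s / 2) ^ p) _ (by positivity : 0 ≤ 1 / p),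
          one_div, ENNReal.rpow_rpow_inv hp.ne', mul_comm, mul_comm κ]
    _ = (∫⁻ _, (s / 2) ^ p * κ ∂ν) ^ (1 / p) := by rw [lintegral_const]
    _ ≤ varP ν p :=
        ENNReal.rpow_le_rpow (lintegral_mono inner_bound) (by positivity)

/-- The distance function to `A` separates `A` from `B` by their distance. -/
theorem mul_half_setSep_le_obsVar {X : Type*} [MetricSpace X] [MeasurableSpace X] [BorelSpace X]
    (μ : Measure X) {p : ℝ} (hp : 0 < p) {κ : ℝ≥0∞} {A B : Set X}
    (hA : A.Nonempty) (hB : B.Nonempty) (hκA : κ ≤ μ A) (hκB : κ ≤ μ B) :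
    (μ Set.univ * κ) ^ (1 / p) * (setSep A B / 2) ≤ obsVar ℝ μ p := by
  have hf : LipschitzWith 1 fun x => Metric.infDist x A := Metric.lipschitz_infDist_pt A
  have hfm : Measurable fun x => Metric.infDist x A := hf.continuous.measurable
  obtain ⟨a₀, ha₀⟩ := hA
  obtain ⟨b₀, hb₀⟩ := hB
  have hfin : setSep A B ≠ ⊤ :=
    ((setSep_le_edist ha₀ hb₀).trans_lt (edist_lt_top a₀ b₀)).ne
  have huniv : Measure.map (fun x => Metric.infDist x A) μ Set.univ = μ Set.univ := by
    rw [Measure.map_apply hfm MeasurableSet.univ, Set.preimage_univ]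
  rw [← huniv]
  refine (mul_half_le_varP _ hp (measurableSet_singleton 0)
    (measurableSet_Ici (a := (setSep A B).toReal)) ?_ ?_ ?_).trans
    (le_iSup₂ (f := fun (f : X → ℝ) (_ : LipschitzWith 1 f) => varP (Measure.map f μ) p) _ hf)
  · rw [Measure.map_apply hfm (measurableSet_singleton 0)]
    exact hκA.trans (measure_mono fun a ha => Metric.infDist_zero_of_mem ha)
  · rw [Measure.map_apply hfm measurableSet_Ici]
    refine hκB.trans (measure_mono fun b hb => ?_)
    refine ENNReal.toReal_mono (Metric.infEDist_ne_top ⟨a₀, ha₀⟩)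
      (Metric.le_infEDist.2 fun a ha => ?_)
    rw [edist_comm]
    exact setSep_le_edist ha hb
  · rintro _ rfl b hb
    rw [edist_comm, edist_dist, Real.dist_0_eq_abs, ← ENNReal.ofReal_toReal hfin]
    exact ENNReal.ofReal_le_ofReal (hb.trans (le_abs_self b))

/-- For an mm-space `X` with `m = μ_X(X) > 0`, `p ≥ 1` and `κ > 0`,
`Sep(X; κ, κ) ≤ 2 (mκ)^{-1/p} · ObsL^pVar_ℝ(X)` (in `ℝ≥0∞`). -/
theorem sep_le_two_obsVar {X : Type*} [MetricSpace X] [CompleteSpace X]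
    [TopologicalSpace.SeparableSpace X] [MeasurableSpace X] [BorelSpace X]
    (μ : Measure X) [IsFiniteMeasure μ] (hm : 0 < μ Set.univ)
    (p : ℝ) (hp : 1 ≤ p) (κ : ℝ≥0∞) (hκ0 : 0 < κ) (hκ : κ ≠ ⊤) :
    sep μ κ κ ≤ 2 * (μ Set.univ * κ) ^ (-(1 / p)) * obsVar ℝ μ p := by
  have hp0 : 0 < p := one_pos.trans_le hp
  refine iSup₂_le fun A B => iSup₂_le fun _ _ => iSup₂_le fun hκA hκB => ?_
  have key := mul_half_setSep_le_obsVar μ hp0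
    (nonempty_of_measure_ne_zero (hκ0.trans_le hκA).ne')
    (nonempty_of_measure_ne_zero (hκ0.trans_le hκB).ne') hκA hκB
  have hne0 : μ Set.univ * κ ≠ 0 := mul_ne_zero hm.ne' hκ0.ne'
  have hne_top : μ Set.univ * κ ≠ ⊤ := ENNReal.mul_ne_top (measure_ne_top μ _) hκ
  calc setSep A B
      = 2 * ((μ Set.univ * κ) ^ (-(1 / p)) * (μ Set.univ * κ) ^ (1 / p)) * (setSep A B / 2) := by
        rw [← ENNReal.rpow_add _ _ hne0 hne_top, neg_add_cancel, ENNReal.rpow_zero, mul_one,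
          ENNReal.mul_div_cancel two_ne_zero ENNReal.ofNat_ne_top]
    _ = 2 * (μ Set.univ * κ) ^ (-(1 / p)) * ((μ Set.univ * κ) ^ (1 / p) * (setSep A B / 2)) := by
        ring
    _ ≤ 2 * (μ Set.univ * κ) ^ (-(1 / p)) * obsVar ℝ μ p := by gcongr
end

section
/- Let T be an ℝ-tree and ν a finite Borel measure on T with separable support and finite first moment, and suppose ν has a center of mass c(ν). Then for every connected component C of T \ {c(ν)}, writing T' = C ∪ {c(ν)}, one has c_{c(ν),T'}(ν) := ∫_{T'} d(c(ν), w) dν(w) − ∫_{T \ T'} d(c(ν), w) dν(w) ≤ 0. -/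
open MeasureTheory ENNReal

open Filter Topology

/-- In an `ℝ`-tree, the component of `x` in the complement of `c` consists of the points having
positive Gromov product with `x` based at `c`. -/
theorem IsRTree.connectedComponentIn_compl_singleton {T : Type*} [MetricSpace T]
    (hT : IsRTree T) {c x : T} (hx : x ≠ c) :
    connectedComponentIn ({c}ᶜ) x = {w | dist x w < dist c x + dist c w} := by
  obtain ⟨-, hgeo, hyp⟩ := hT
  apply Set.Subset.antisymm
  · have hU : IsOpen {w | dist x w < dist c x + dist c w} :=
      isOpen_lt (by fun_prop) (by fun_prop)
    have hV : IsOpen {w | w ≠ c ∧ dist c x + dist c w ≤ dist x w} := by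
      rw [Metric.isOpen_iff]
      rintro w ⟨hwc, hw⟩
      refine ⟨dist c w, dist_pos.2 hwc.symm, fun v hv ↦ ?_⟩
      rw [Metric.mem_ball] at hv
      refine ⟨?_, ?_⟩
      · rintro rfl
        exact lt_irrefl _ hv
      · have h1 := hyp x w c v
        have h2 := dist_triangle c v w
        rw [dist_comm w c, dist_comm x c, dist_comm w v] at h1
        rcases le_max_iff.1 h1 with h | h <;> linarith
    refine isPreconnected_connectedComponentIn.subset_left_of_subset_union hU hV ?_ ?_ ?_
    · rw [Set.disjoint_left]
      rintro w hw ⟨-, hw'⟩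
      exact absurd hw (not_lt.2 hw')
    · intro w hw
      by_cases h : dist x w < dist c x + dist c w
      · exact Or.inl h
      · exact Or.inr ⟨connectedComponentIn_subset _ _ hw, not_lt.1 h⟩
    · exact ⟨x, mem_connectedComponentIn hx, by simpa using hx.symm⟩
  · intro w hw
    obtain ⟨γ, h0, h1, hγ⟩ := hgeo x w
    have hcont : ContinuousOn γ (Set.Icc 0 (dist x w)) := by
      refine LipschitzOnWith.continuousOn (K := 1) (LipschitzOnWith.of_dist_le_mul ?_)
      intro s hs t ht
      rw [hγ s hs t ht, Real.dist_eq, NNReal.coe_one, one_mul]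
    have hl : (0 : ℝ) ∈ Set.Icc 0 (dist x w) := ⟨le_rfl, dist_nonneg⟩
    have hr : dist x w ∈ Set.Icc 0 (dist x w) := ⟨dist_nonneg, le_rfl⟩
    refine (isPreconnected_Icc.image γ hcont).subset_connectedComponentIn
      ⟨0, hl, h0⟩ ?_ ⟨dist x w, hr, h1⟩
    rintro _ ⟨t, ht, rfl⟩ (htc : γ t = c)
    have e0 := hγ t ht 0 hl
    have e1 := hγ t ht _ hr
    rw [htc, h0, sub_zero, abs_of_nonneg ht.1] at e0
    rw [htc, h1, abs_sub_comm, abs_of_nonneg (sub_nonneg.2 ht.2)] at e1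
    have : dist x w < dist c x + dist c w := hw
    linarith

/-- A finite first moment at one point yields integrability of the distance to any point. -/
theorem FiniteFirstMoment.integrable_dist {T : Type*} [MetricSpace T] [MeasurableSpace T]
    [BorelSpace T] {ν : Measure T} [IsFiniteMeasure ν] (h : FiniteFirstMoment ν) (c : T) :
    Integrable (fun w ↦ dist c w) ν := by
  obtain ⟨a, ha⟩ := h
  have hint : Integrable (fun w ↦ dist a w) ν := by
    refine ⟨(by fun_prop : Continuous fun w ↦ dist a w).aestronglyMeasurable, ?_⟩
    rw [hasFiniteIntegral_iff_ofReal (Eventually.of_forall fun _ ↦ dist_nonneg)]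
    simpa only [← edist_dist] using ha
  refine ((integrable_const (dist c a)).add hint).mono'
    (by fun_prop : Continuous fun w ↦ dist c w).aestronglyMeasurable
    (Eventually.of_forall fun w ↦ ?_)
  rw [Real.norm_of_nonneg dist_nonneg]
  exact dist_triangle c a w

/-- Moving the base point from `c` a distance `t` towards `x` changes the squared distance to `w`
by at most `t (t - 2 d(c,w))` if `t` is at most the Gromov product of `x` and `w` at `c`,
and by at most `t (t + 2 d(c,w))` otherwise. -/
theorem IsRTree.dist_sq_sub_dist_sq_le {T : Type*} [MetricSpace T] (hT : IsRTree T)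
    {c x p : T} (hp : dist c p + dist p x = dist c x) (w : T) :
    dist p w ^ 2 - dist c w ^ 2 ≤ dist c p * (dist c p +
      if 2 * dist c p ≤ dist c x + dist c w - dist x w then -(2 * dist c w)
      else 2 * dist c w) := by
  have hpw : 0 ≤ dist p w := dist_nonneg
  split_ifs with h
  · have h4 := hT.2.2 p w c x
    rw [dist_comm p c, dist_comm w c, dist_comm w x] at h4
    have : dist p w ≤ dist c w - dist c p := by
      rcases le_max_iff.1 h4 with h | h <;> linarith
    nlinarith
  · have h3 := dist_triangle_left p w c
    nlinarith [dist_nonneg (x := c) (y := p), dist_nonneg (x := c) (y := w)]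

/-- For a finite Borel measure `ν` with separable support and finite first moment
on an `ℝ`-tree `T`, with center of mass `c`, for every connected component `C` of `T \ {c}`
(with `T' = C ∪ {c}`) one has `∫_{T'} d(c,w) dν(w) - ∫_{T \ T'} d(c,w) dν(w) ≤ 0`. -/
theorem center_of_mass_component_ineq {T : Type*} [MetricSpace T] [MeasurableSpace T]
    [BorelSpace T] (hT : IsRTree T)
    (ν : Measure T) [IsFiniteMeasure ν]
    (hsep : HasSeparableSupport ν) (hmom : FiniteFirstMoment ν)
    (c : T) (hc : IsCenterOfMass ν c) (x : T) (hx : x ≠ c) :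
    (∫ w in connectedComponentIn ({c}ᶜ) x ∪ {c}, dist c w ∂ν)
      - ∫ w in (connectedComponentIn ({c}ᶜ) x ∪ {c})ᶜ, dist c w ∂ν ≤ 0 := by
  classical
  have hd := hmom.integrable_dist c
  have hcx : 0 < dist c x := dist_pos.2 hx.symm
  rw [hT.connectedComponentIn_compl_singleton hx]
  set A : Set T := {w | dist x w < dist c x + dist c w} ∪ {c} with hA
  have hAm : MeasurableSet A :=
    (isOpen_lt (by fun_prop) (by fun_prop)).measurableSet.union (measurableSet_singleton c)
  let G : ℝ → T → ℝ := fun t w ↦ t +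
    if 2 * t ≤ dist c x + dist c w - dist x w then -(2 * dist c w) else 2 * dist c w
  have hGm (t : ℝ) : AEStronglyMeasurable (G t) ν := by
    have hS : MeasurableSet {w | 2 * t ≤ dist c x + dist c w - dist x w} :=
      (isClosed_le (by fun_prop) (by fun_prop)).measurableSet
    have hm : Measurable fun w ↦ dist c w :=
      (by fun_prop : Continuous fun w ↦ dist c w).measurable
    exact (measurable_const.add
      (Measurable.ite hS (hm.const_mul 2).neg (hm.const_mul 2))).aestronglyMeasurable
  have hsmall : ∀ᶠ t in 𝓝[>] (0 : ℝ), t ∈ Set.Ioc 0 (dist c x) := Ioc_mem_nhdsGT hcx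
  have hGb (t : ℝ) (ht : t ∈ Set.Ioc 0 (dist c x)) (w : T) :
      ‖G t w‖ ≤ dist c x + 2 * dist c w := by
    have hw : 0 ≤ dist c w := dist_nonneg
    rw [Real.norm_eq_abs, abs_le]
    obtain ⟨h0, h1⟩ := ht
    dsimp only [G]
    split_ifs <;> constructor <;> linarith
  have hbound : Integrable (fun w ↦ dist c x + 2 * dist c w) ν :=
    (integrable_const _).add (hd.const_mul 2)
  have hlim : Tendsto (fun t ↦ ∫ w, G t w ∂ν) (𝓝[>] 0)
      (𝓝 (∫ w, A.piecewise (fun w ↦ -(2 * dist c w)) (fun w ↦ 2 * dist c w) w ∂ν)) := by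
    refine tendsto_integral_filter_of_dominated_convergence _ (Eventually.of_forall hGm)
      (hsmall.mono fun t ht ↦ Eventually.of_forall (hGb t ht)) hbound
      (Eventually.of_forall fun w ↦ ?_)
    have key : ∀ᶠ t in 𝓝[>] (0 : ℝ),
        t + A.piecewise (fun w ↦ -(2 * dist c w)) (fun w ↦ 2 * dist c w) w = G t w := by
      by_cases hwc : w = c
      · subst hwc
        exact Eventually.of_forall fun t ↦ by simp [G, Set.piecewise]
      by_cases hw : dist x w < dist c x + dist c w
      · have hpos : 0 < (dist c x + dist c w - dist x w) / 2 := by linarith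
        filter_upwards [Ioc_mem_nhdsGT hpos] with t ht
        have hle : 2 * t ≤ dist c x + dist c w - dist x w := by linarith [ht.2]
        rw [Set.piecewise_eq_of_mem _ _ _ (show w ∈ A from Or.inl hw)]
        simp only [G, if_pos hle]
      · filter_upwards [self_mem_nhdsWithin] with t ht
        have ht0 : 0 < t := ht
        have hle : ¬ 2 * t ≤ dist c x + dist c w - dist x w := by linarith
        rw [Set.piecewise_eq_of_notMem _ _ _ (by simp [hA, hwc, not_lt.1 hw])]
        simp only [G, if_neg hle]
    refine Tendsto.congr' key ?_
    have hid : Tendsto (fun t : ℝ ↦ t) (𝓝[>] 0) (𝓝 0) := tendsto_id.mono_left nhdsWithin_le_nhds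
    simpa using hid.add_const (A.piecewise (fun w ↦ -(2 * dist c w)) (fun w ↦ 2 * dist c w) w)
  have hnonneg : 0 ≤ ∫ w, A.piecewise (fun w ↦ -(2 * dist c w)) (fun w ↦ 2 * dist c w) w ∂ν := by
    refine ge_of_tendsto hlim (hsmall.mono fun t ht ↦ ?_)
    obtain ⟨γ, h0, h1, hγ⟩ := hT.2.1 c x
    have htI : t ∈ Set.Icc 0 (dist c x) := ⟨ht.1.le, ht.2⟩
    have hcp : dist c (γ t) = t := by
      have := hγ 0 ⟨le_rfl, dist_nonneg⟩ t htI
      rwa [h0, zero_sub, abs_neg, abs_of_pos ht.1] at this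
    have hpx : dist (γ t) x = dist c x - t := by
      have := hγ t htI _ ⟨dist_nonneg, le_rfl⟩
      rwa [h1, abs_sub_comm, abs_of_nonneg (sub_nonneg.2 ht.2)] at this
    have hpc : γ t ≠ c := fun h ↦ by
      rw [h, dist_self] at hcp
      exact ht.1.ne hcp
    have hpos := hc c (γ t) hpc
    simp only [sub_self, integral_zero] at hpos
    have hint : Integrable (fun y ↦ dist (γ t) y ^ 2 - dist c y ^ 2) ν := by
      by_contra hni
      exact hpos.ne' (integral_undef hni)
    have hGi : Integrable (G t) ν := hbound.mono' (hGm t) (Eventually.of_forall (hGb t ht))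
    have hle := integral_mono hint (hGi.const_mul t) fun w ↦ by
      have hle := hT.dist_sq_sub_dist_sq_le (by linarith : dist c (γ t) + _ = dist c x) w
      rwa [hcp] at hle
    rw [integral_const_mul] at hle
    exact (pos_of_mul_pos_right (hpos.trans_le hle) ht.1.le).le
  have hd2 := hd.const_mul 2
  have hd2n : Integrable (fun w ↦ -(2 * dist c w)) ν := hd2.neg
  rw [integral_piecewise hAm hd2n.integrableOn hd2.integrableOn, integral_neg,
    integral_const_mul, integral_const_mul] at hnonneg
  linarith
end

section
/- Let T be an ℝ-tree, ν a finite Borel measure on T with m = ν(T), and m_ν a median of ν. Then for any κ > 0, ν(B(m_ν, Sep(ν; m/3, κ/2))) ≥ m − κ, where B denotes a closed ball. -/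
open MeasureTheory ENNReal

/-- In a geodesic space covered by two closed sets meeting only at `z`, the distance from a point of
one of them to a point of the other is at least the distance from `z`. -/
theorem dist_le_of_closed_cover {T : Type*} [MetricSpace T]
    (hgeo : ∀ x y : T, ∃ γ : ℝ → T, IsGeodesic x y γ) {P Q : Set T} {z : T}
    (hP : IsClosed P) (hQ : IsClosed Q) (hcover : P ∪ Q = Set.univ) (hinter : P ∩ Q = {z})
    {x y : T} (hx : x ∈ Q) (hy : y ∈ P) : dist z y ≤ dist x y := by
  obtain ⟨γ, h0, h1, hγ⟩ := hgeo x y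
  have hd : (0 : ℝ) ≤ dist x y := dist_nonneg
  have hcont : ContinuousOn γ (Set.Icc 0 (dist x y)) := by
    have hlip : LipschitzOnWith 1 γ (Set.Icc 0 (dist x y)) :=
      LipschitzOnWith.of_dist_le_mul fun s hs t ht => by
        rw [hγ s hs t ht, Real.dist_eq]; simp
    exact hlip.continuousOn
  have hpre := isPreconnected_closed_iff.1 (isPreconnected_Icc.image γ hcont) P Q hP hQ
    (by rw [hcover]; exact Set.subset_univ _)
    ⟨y, ⟨_, Set.right_mem_Icc.2 hd, h1⟩, hy⟩ ⟨x, ⟨_, Set.left_mem_Icc.2 hd, h0⟩, hx⟩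
  obtain ⟨w, ⟨t, ht, rfl⟩, hw⟩ := hpre
  rw [hinter, Set.mem_singleton_iff] at hw
  have hdist := hγ t ht _ (Set.right_mem_Icc.2 hd)
  rw [hw, h1] at hdist
  rw [hdist, abs_le]
  constructor <;> linarith [ht.1, ht.2]

/-- If the superlevel sets `{r ≤ f}` with `r > S` all have measure at most `c`, so does `{S < f}`. -/
theorem measure_lt_le_of_forall_measure_le {α : Type*} [MeasurableSpace α] (μ : Measure α)
    (f : α → ℝ≥0∞) (S c : ℝ≥0∞) (h : ∀ r, S < r → μ {x | r ≤ f x} ≤ c) :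
    μ {x | S < f x} ≤ c := by
  rcases eq_or_ne S ⊤ with rfl | hS
  · simp
  obtain ⟨u, hu, hSu, hlim⟩ := exists_seq_strictAnti_tendsto' (lt_top_iff_ne_top.2 hS)
  have hunion : {x | S < f x} = ⋃ n, {x | u n ≤ f x} := by
    ext x
    simp only [Set.mem_ofPred_eq, Set.mem_iUnion]
    constructor
    · intro hx
      obtain ⟨n, hn⟩ := (hlim.eventually_lt_const hx).exists
      exact ⟨n, hn.le⟩
    · rintro ⟨n, hn⟩
      exact (hSu n).1.trans_le hn
  have hmono : Monotone fun n => {x | u n ≤ f x} := fun m n hmn x hx =>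
    (hu.antitone hmn).trans hx
  rw [hunion, hmono.measure_iUnion]
  exact iSup_le fun n => h _ (hSu n).1

/-- In a geodesic space covered by two closed sets `P`, `Q` meeting only at `z`, with `Q` of measure
at least `a`, the part of `P` further than `sep ν a b` from `z` has measure at most `b`. -/
theorem measure_inter_compl_closedEBall_le {T : Type*} [MetricSpace T] [MeasurableSpace T]
    [BorelSpace T] (hgeo : ∀ x y : T, ∃ γ : ℝ → T, IsGeodesic x y γ) (ν : Measure T)
    {P Q : Set T} {z : T} (hP : IsClosed P) (hQ : IsClosed Q) (hcover : P ∪ Q = Set.univ)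
    (hinter : P ∩ Q = {z}) {a b : ℝ≥0∞} (ha : a ≤ ν Q) :
    ν ((Metric.closedEBall z (sep ν a b))ᶜ ∩ P) ≤ b := by
  have hball : (Metric.closedEBall z (sep ν a b))ᶜ = {x | sep ν a b < edist x z} := by
    ext x; simp
  rw [hball, ← Measure.restrict_apply' hP.measurableSet]
  refine measure_lt_le_of_forall_measure_le _ _ _ _ fun r hr => ?_
  rw [Measure.restrict_apply' hP.measurableSet]
  by_contra! hb
  have hmeas : MeasurableSet ({x | r ≤ edist x z} ∩ P) :=
    ((isClosed_le continuous_const (continuous_id.edist continuous_const)).inter hP).measurableSet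
  have hsep : r ≤ setSep Q ({x | r ≤ edist x z} ∩ P) := by
    refine le_iInf₂ fun x hx => Metric.le_infEDist.2 fun y hy => hy.1.trans ?_
    rw [edist_comm, edist_dist, edist_dist]
    exact ENNReal.ofReal_le_ofReal (dist_le_of_closed_cover hgeo hP hQ hcover hinter hx hy.2)
  have hle : setSep Q ({x | r ≤ edist x z} ∩ P) ≤ sep ν a b :=
    le_iSup_of_le Q <| le_iSup_of_le _ <| le_iSup_of_le hQ.measurableSet <|
      le_iSup_of_le hmeas <| le_iSup_of_le ha <| le_iSup_of_le hb.le le_rfl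
  exact absurd (hsep.trans hle) (not_le.2 hr)

/-- For a finite Borel measure `ν` on an `ℝ`-tree with median `m_ν` and any
`κ > 0`, `ν(B(m_ν, Sep(ν; m/3, κ/2))) ≥ m - κ`. -/
theorem measure_closedBall_median {T : Type*} [MetricSpace T] [MeasurableSpace T] [BorelSpace T]
    (hT : IsRTree T) (ν : Measure T) [IsFiniteMeasure ν]
    (z : T) (hz : IsMedian ν z)
    (κ : ℝ≥0∞) (hκ0 : 0 < κ) (hκ : κ ≠ ⊤) :
    ν Set.univ - κ ≤ ν (EMetric.closedBall z (sep ν (ν Set.univ / 3) (κ / 2))) := by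
  obtain ⟨P, Q, hP, hQ, -, -, hcover, hinter, hmP, hmQ⟩ := hz
  set B := EMetric.closedBall z (sep ν (ν Set.univ / 3) (κ / 2))
  have h1 : ν (Bᶜ ∩ P) ≤ κ / 2 :=
    measure_inter_compl_closedEBall_le hT.2.1 ν hP hQ hcover hinter hmQ
  have h2 : ν (Bᶜ ∩ Q) ≤ κ / 2 :=
    measure_inter_compl_closedEBall_le hT.2.1 ν hQ hP (by rwa [Set.union_comm])
      (by rwa [Set.inter_comm]) hmP
  rw [tsub_le_iff_right]
  calc ν Set.univ = ν (B ∪ (Bᶜ ∩ P ∪ Bᶜ ∩ Q)) := by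
        rw [← Set.inter_union_distrib_left, hcover, Set.inter_univ, Set.union_compl_self]
    _ ≤ ν B + (ν (Bᶜ ∩ P) + ν (Bᶜ ∩ Q)) :=
        (measure_union_le _ _).trans (by gcongr; exact measure_union_le _ _)
    _ ≤ ν B + (κ / 2 + κ / 2) := by gcongr
    _ = ν B + κ := by rw [ENNReal.add_halves]
end

section
/- Let X be an mm-space with total mass m = μ_X(X) and T an ℝ-tree. Then for any κ > 0, ObsDiam_T(X; −κ) ≤ 2·Sep(X; κ/3, κ/3) + 4·ObsDiam_ℝ(X; −κ). -/
open MeasureTheory ENNReal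

/-- In a `0`-hyperbolic space, a point between `a` and `b` is at most as far from `y` as the
farther of `a` and `b`. -/
lemma IsRTree.dist_le_max_of_between {T : Type*} [MetricSpace T] (hT : IsRTree T) {a b z : T}
    (h : dist a b = dist a z + dist z b) (y : T) : dist y z ≤ max (dist y a) (dist y b) := by
  have h4 := hT.2.2 y z a b
  have := dist_nonneg (x := a) (y := z)
  have := dist_nonneg (x := z) (y := b)
  rw [dist_comm z a] at h4
  rcases le_max_iff.1 h4 with h' | h'
  · exact le_max_of_le_left (by linarith)
  · exact le_max_of_le_right (by linarith)

/-- Among finitely many (at least two) points of an `ℝ`-tree, two form a cherry: some point `p`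
lies between either of them and each of the remaining points. -/
lemma IsRTree.exists_cherry {T : Type*} [MetricSpace T] (hT : IsRTree T) {ι : Type*}
    [DecidableEq ι] (s : Finset ι) (hs : 1 < s.card) (x : ι → T) :
    ∃ i ∈ s, ∃ j ∈ s, i ≠ j ∧ ∃ p : T, ∀ k ∈ s, k ≠ i → k ≠ j →
      dist (x i) (x k) = dist (x i) p + dist p (x k) ∧
      dist (x j) (x k) = dist (x j) p + dist p (x k) := by
  obtain ⟨a, ha, b, hb, hab⟩ := Finset.one_lt_card.1 hs
  have hne : s.offDiag.Nonempty := ⟨(a, b), Finset.mem_offDiag.2 ⟨ha, hb, hab⟩⟩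
  set o := x a
  obtain ⟨⟨i, j⟩, hij, hmax⟩ := s.offDiag.exists_max_image
    (fun q => dist o (x q.1) + dist o (x q.2) - dist (x q.1) (x q.2)) hne
  obtain ⟨hi, hj, hne'⟩ := Finset.mem_offDiag.1 hij
  simp only at hi hj hne'
  obtain ⟨γ, h0, h1, hγ⟩ := hT.2.1 (x i) (x j)
  set t : ℝ := (dist (x i) (x j) + dist o (x i) - dist o (x j)) / 2 with ht
  have tri1 := dist_triangle o (x i) (x j)
  have tri2 := dist_triangle o (x j) (x i)
  have tri3 := dist_triangle (x i) o (x j)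
  rw [dist_comm (x j) (x i)] at tri2
  rw [dist_comm (x i) o] at tri3
  have htm : t ∈ Set.Icc (0 : ℝ) (dist (x i) (x j)) := ⟨by linarith, by linarith⟩
  have hip : dist (x i) (γ t) = t := by
    have := hγ 0 ⟨le_rfl, dist_nonneg⟩ t htm
    rw [h0] at this
    rw [this, zero_sub, abs_neg, abs_of_nonneg htm.1]
  have hjp : dist (x j) (γ t) = dist (x i) (x j) - t := by
    have := hγ (dist (x i) (x j)) ⟨dist_nonneg, le_rfl⟩ t htm
    rw [h1] at this
    rw [this, abs_of_nonneg (by linarith [htm.2])]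
  refine ⟨i, hi, j, hj, hne', γ t, fun k hk hki hkj => ?_⟩
  have g1 := hmax (i, k) (Finset.mem_offDiag.2 ⟨hi, hk, hki.symm⟩)
  have g2 := hmax (j, k) (Finset.mem_offDiag.2 ⟨hj, hk, hkj.symm⟩)
  simp only at g1 g2
  have e1 := hT.2.2 o (x i) (x j) (x k)
  have e2 := hT.2.2 o (x j) (x i) (x k)
  have e3 := hT.2.2 (x k) (γ t) (x i) (x j)
  have u1 := dist_triangle (x i) (γ t) (x k)
  have u2 := dist_triangle (x j) (γ t) (x k)
  rw [dist_comm (x j) (x i)] at e2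
  rw [dist_comm (x k) (γ t), dist_comm (γ t) (x i), dist_comm (γ t) (x j), dist_comm (x k) (x i),
    dist_comm (x k) (x j)] at e3
  have heq : dist o (x i) + dist (x j) (x k) = dist o (x j) + dist (x i) (x k) := by
    rcases le_max_iff.1 e1 with e1 | e1 <;> rcases le_max_iff.1 e2 with e2 | e2 <;> linarith
  constructor
  · rcases le_max_iff.1 e3 with e3 | e3 <;> linarith
  · rcases le_max_iff.1 e3 with e3 | e3 <;> linarith

/-- Finitely many weighted points of an `ℝ`-tree, each of weight less than a third of a lower bound
of the total weight, can be split by a point of the tree into two parts of weight at least that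
third. -/
lemma IsRTree.exists_split {T : Type*} [MetricSpace T] (hT : IsRTree T) {ι : Type*}
    [DecidableEq ι] {c : ℝ} (hc : 0 < c) (n : ℕ) : ∀ (s : Finset ι) (x : ι → T) (w : ι → ℝ),
    s.card = n → (∀ i ∈ s, w i < c) → 3 * c ≤ ∑ i ∈ s, w i →
    ∃ (z : T) (S : ι → Bool), c ≤ ∑ i ∈ s, (if S i then w i else 0) ∧
      c ≤ ∑ i ∈ s, (if S i then 0 else w i) ∧
      ∀ i ∈ s, ∀ j ∈ s, S i = true → S j = false →
        dist (x i) (x j) = dist (x i) z + dist z (x j) := by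
  induction n with
  | zero =>
    intro s x w hs _ hw
    rw [Finset.card_eq_zero] at hs
    subst hs
    simp only [Finset.sum_empty] at hw
    linarith
  | succ n ih =>
    intro s x w hs hlt hw
    have hcard : 1 < s.card := by
      by_contra hle
      obtain ⟨a, ha⟩ := Finset.card_eq_one.1 (show s.card = 1 by omega)
      subst ha
      rw [Finset.sum_singleton] at hw
      linarith [hlt a (Finset.mem_singleton_self a)]
    obtain ⟨i, hi, j, hj, hij, p, hp⟩ := hT.exists_cherry s hcard x
    have hi' : i ∈ s.erase j := Finset.mem_erase.2 ⟨hij, hi⟩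
    have hsum (g : ι → ℝ) : ∑ k ∈ s, g k = g j + (g i + ∑ k ∈ (s.erase j).erase i, g k) := by
      rw [Finset.add_sum_erase _ _ hi', Finset.add_sum_erase _ _ hj]
    by_cases hwij : c ≤ w i + w j
    · refine ⟨p, fun k => decide (k = i ∨ k = j), ?_, ?_, ?_⟩
      · rw [hsum, Finset.sum_eq_zero]
        · simp only [true_or, or_true, decide_true, if_true]
          linarith
        · intro k hk
          simp only [Finset.mem_erase] at hk
          simp [hk.1, hk.2.1]
      · rw [hsum] at hw ⊢
        have : ∑ k ∈ (s.erase j).erase i, (if decide (k = i ∨ k = j) = true then 0 else w k)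
            = ∑ k ∈ (s.erase j).erase i, w k := by
          refine Finset.sum_congr rfl fun k hk => ?_
          simp only [Finset.mem_erase] at hk
          simp [hk.1, hk.2.1]
        rw [this]
        simp only [true_or, or_true, decide_true, if_true]
        linarith [hlt i hi, hlt j hj]
      · intro a _ b hb hSa hSb
        simp only [decide_eq_true_eq, decide_eq_false_iff_not, not_or] at hSa hSb
        have := hp b hb hSb.1 hSb.2
        rcases hSa with rfl | rfl
        exacts [this.1, this.2]
    · push Not at hwij
      have hsum' (g : ι → ℝ) : ∑ k ∈ s.erase j, g k
          = g i + ∑ k ∈ (s.erase j).erase i, g k := by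
        rw [Finset.add_sum_erase _ _ hi']
      have hupd (S : ι → Bool) (F : Bool → ℝ → ℝ)
          (hF : ∀ b u v, F b (u + v) = F b u + F b v) :
          ∑ k ∈ s.erase j, F (S k) (Function.update w i (w i + w j) k)
            = ∑ k ∈ s, F (Function.update S j (S i) k) (w k) := by
        rw [hsum, hsum', Function.update_self, Function.update_self,
          Function.update_of_ne hij, hF]
        have : ∑ k ∈ (s.erase j).erase i, F (S k) (Function.update w i (w i + w j) k)
            = ∑ k ∈ (s.erase j).erase i, F (Function.update S j (S i) k) (w k) := by
          refine Finset.sum_congr rfl fun k hk => ?_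
          simp only [Finset.mem_erase] at hk
          rw [Function.update_of_ne hk.1, Function.update_of_ne hk.2.1]
        rw [this]
        ring
      obtain ⟨z, S, h1, h2, h3⟩ := ih (s.erase j) (Function.update x i p)
        (Function.update w i (w i + w j)) (by rw [Finset.card_erase_of_mem hj, hs]; rfl)
        (by
          intro k hk
          by_cases hki : k = i
          · subst hki
            simpa using hwij
          · rw [Function.update_of_ne hki]
            exact hlt k (Finset.mem_of_mem_erase hk))
        (by
          rw [hupd (fun _ => true) (fun _ u => u) (fun _ _ _ => rfl)]
          exact hw)
      refine ⟨z, Function.update S j (S i), ?_, ?_, ?_⟩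
      · rwa [hupd S (fun b u => if b then u else 0) (by intro b u v; cases b <;> simp)] at h1
      · rwa [hupd S (fun b u => if b then 0 else u) (by intro b u v; cases b <;> simp)] at h2
      -- a point between the merged point and another one is between the original points
      have lift {a q b : T} (hab : dist a b = dist a q + dist q b)
          (hqb : dist q b = dist q z + dist z b) : dist a b = dist a z + dist z b := by
        linarith [dist_triangle a z b, dist_triangle a q z]
      have rep (k : ι) (hk : k ∈ s) : ∃ k' ∈ s.erase j, Function.update S j (S i) k = S k' ∧
          ((k' = i ∧ (k = i ∨ k = j)) ∨ (k' = k ∧ k ≠ i ∧ k ≠ j)) := by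
        by_cases hkj : k = j
        · subst hkj
          exact ⟨i, hi', by simp, Or.inl ⟨rfl, Or.inr rfl⟩⟩
        · refine ⟨k, Finset.mem_erase.2 ⟨hkj, hk⟩, by rw [Function.update_of_ne hkj], ?_⟩
          by_cases hki : k = i
          · exact Or.inl ⟨hki, Or.inl hki⟩
          · exact Or.inr ⟨rfl, hki, hkj⟩
      intro a ha b hb hSa hSb
      obtain ⟨a', ha', hSa', hca⟩ := rep a ha
      obtain ⟨b', hb', hSb', hcb⟩ := rep b hb
      rw [hSa'] at hSa
      rw [hSb'] at hSb
      have key := h3 a' ha' b' hb' hSa hSb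
      rcases hca with ⟨rfl, hca⟩ | ⟨rfl, hai, haj⟩ <;>
        rcases hcb with ⟨rfl, hcb⟩ | ⟨rfl, hbi, hbj⟩
      · rw [hSa] at hSb
        cases hSb
      · rw [Function.update_self, Function.update_of_ne hbi] at key
        have := hp b' hb hbi hbj
        rcases hca with rfl | rfl
        exacts [lift this.1 key, lift this.2 key]
      · rw [Function.update_self, Function.update_of_ne hai] at key
        have := hp a' ha hai haj
        have flip {q q' : T} (h : dist q q' = dist q z + dist z q') :
            dist q' q = dist q' z + dist z q := by
          rw [dist_comm q' q, dist_comm q' z, dist_comm z q, h, add_comm]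
        rcases hcb with rfl | rfl
        exacts [flip (lift this.1 (flip key)), flip (lift this.2 (flip key))]
      · rwa [Function.update_of_ne hai, Function.update_of_ne hbi] at key

lemma partialDiam_le {α : Type*} [PseudoEMetricSpace α] [MeasurableSpace α] {ν : Measure α}
    {a : ℝ≥0∞} {s : Set α} (hs : MeasurableSet s) (ha : a ≤ ν s) :
    partialDiam ν a ≤ Metric.ediam s :=
  iInf_le_of_le s <| iInf₂_le hs ha

/-- The points at distance at least `r > Sep(μ; κ, κ)` from a set of measure at least `κ` have
measure less than `κ`. -/
lemma measure_le_infEdist_lt_of_sep_lt {X : Type*} [PseudoEMetricSpace X] [MeasurableSpace X]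
    [BorelSpace X] {μ : Measure X} {κ r : ℝ≥0∞} (hr : sep μ κ κ < r) {A : Set X}
    (hA : MeasurableSet A) (hκ : κ ≤ μ A) : μ {x | r ≤ Metric.infEDist x A} < κ := by
  by_contra! hle
  have hm : MeasurableSet {x | r ≤ Metric.infEDist x A} :=
    measurableSet_le measurable_const measurable_infEDist
  have h1 : setSep {x | r ≤ Metric.infEDist x A} A ≤ sep μ κ κ :=
    le_iSup_of_le _ <| le_iSup_of_le A <| le_iSup_of_le hm <| le_iSup_of_le hA <|
      le_iSup_of_le hle <| le_iSup_of_le hκ le_rfl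
  have h2 : r ≤ setSep {x | r ≤ Metric.infEDist x A} A := le_iInf₂ fun x hx => hx
  exact absurd (h2.trans h1) (not_le.2 hr)

/-- A `1`-Lipschitz map to an `ℝ`-tree has an approximate median: two sets of measure at least
`κ / 3` whose images are separated, up to `δ`, by a point. -/
lemma IsRTree.exists_approx_median {X : Type*} [MetricSpace X]
    [TopologicalSpace.SeparableSpace X] [MeasurableSpace X] [BorelSpace X]
    (μ : Measure X) [IsFiniteMeasure μ] {T : Type*} [MetricSpace T] (hT : IsRTree T)
    {κ : ℝ≥0∞} (hκ0 : 0 < κ) (hκ : κ < μ Set.univ) {f : X → T} (hf : LipschitzWith 1 f)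
    {δ : ℝ} (hδ : 0 < δ) :
    ∃ (z : T) (A B : Set X), MeasurableSet A ∧ MeasurableSet B ∧ κ / 3 ≤ μ A ∧ κ / 3 ≤ μ B ∧
      ∀ a ∈ A, ∀ b ∈ B, ∀ y, dist y z ≤ max (dist y (f a)) (dist y (f b)) + δ := by
  have hκt : κ ≠ ⊤ := hκ.ne_top
  have : Nonempty X := by
    by_contra hX
    rw [not_nonempty_iff] at hX
    rw [Set.univ_eq_empty_iff.2 hX, measure_empty] at hκ
    exact not_lt_bot hκ
  let u := TopologicalSpace.denseSeq X
  let C : ℕ → Set X := disjointed fun n => Metric.ball (u n) δ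
  have hCm (n : ℕ) : MeasurableSet (C n) := MeasurableSet.disjointed (fun _ => measurableSet_ball) n
  have hCd : Pairwise (Function.onFun Disjoint C) := disjoint_disjointed _
  have hCu : ⋃ n, C n = Set.univ := by
    rw [iUnion_disjointed, Set.eq_univ_iff_forall]
    intro x
    obtain ⟨n, hn⟩ := (TopologicalSpace.denseRange_denseSeq X).exists_dist_lt x hδ
    exact Set.mem_iUnion.2 ⟨n, hn⟩
  have hCf (n : ℕ) (a : X) (ha : a ∈ C n) (y : T) : dist y (f (u n)) ≤ dist y (f a) + δ := by
    have h1 : dist a (u n) < δ := disjointed_subset _ n ha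
    have h2 := hf.dist_le_mul a (u n)
    have h3 := dist_triangle y (f a) (f (u n))
    simp only [NNReal.coe_one, one_mul] at h2
    linarith
  have hunion (s : Finset ℕ) : μ (⋃ n ∈ s, C n) = ∑ n ∈ s, μ (C n) :=
    measure_biUnion_finset (fun i _ j _ h => hCd h) fun n _ => hCm n
  obtain ⟨s, hs⟩ : ∃ s : Finset ℕ, κ < ∑ n ∈ s, μ (C n) := by
    rw [← hCu, measure_iUnion hCd hCm, ENNReal.tsum_eq_iSup_sum] at hκ
    exact lt_iSup_iff.1 hκ
  by_cases hbig : ∃ n, κ / 3 ≤ μ (C n)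
  · obtain ⟨n, hn⟩ := hbig
    exact ⟨f (u n), C n, C n, hCm n, hCm n, hn, hn, fun a ha b _ y =>
      (hCf n a ha y).trans (by gcongr; exact le_max_left _ _)⟩
  push Not at hbig
  have hκ3 : κ / 3 ≠ ⊤ := (ENNReal.div_lt_top hκt (by norm_num)).ne
  have hc : (κ / 3).toReal = κ.toReal / 3 := by simp [ENNReal.toReal_div]
  have hreal (s : Finset ℕ) : ∑ n ∈ s, (μ (C n)).toReal = (μ (⋃ n ∈ s, C n)).toReal := by
    rw [hunion, ENNReal.toReal_sum fun n _ => measure_ne_top μ _]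
  have hκpos : 0 < κ.toReal := ENNReal.toReal_pos hκ0.ne' hκt
  obtain ⟨z, S, h1, h2, h3⟩ := hT.exists_split (c := (κ / 3).toReal) (by rw [hc]; linarith) _ s
    (fun n => f (u n)) (fun n => (μ (C n)).toReal) rfl
    (fun n _ => (ENNReal.toReal_lt_toReal (measure_ne_top μ _) hκ3).2 (hbig n))
    (by
      rw [hreal, hunion, hc, mul_div_cancel₀ _ (by norm_num : (3 : ℝ) ≠ 0)]
      exact ENNReal.toReal_mono (by rw [← hunion]; exact measure_ne_top μ _) hs.le)
  have hmeas (s : Finset ℕ) : MeasurableSet (⋃ n ∈ s, C n) :=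
    Finset.measurableSet_biUnion s fun n _ => hCm n
  refine ⟨z, ⋃ n ∈ s.filter (fun n => S n = true), C n, ⋃ n ∈ s.filter (fun n => S n = false), C n,
    hmeas _, hmeas _, ?_, ?_, ?_⟩
  · rw [← ENNReal.toReal_le_toReal hκ3 (measure_ne_top μ _), ← hreal, Finset.sum_filter]
    exact h1
  · rw [← ENNReal.toReal_le_toReal hκ3 (measure_ne_top μ _), ← hreal, Finset.sum_filter]
    refine h2.trans_eq (Finset.sum_congr rfl fun n _ => ?_)
    cases S n <;> simp
  · intro a ha b hb y
    simp only [Set.mem_iUnion, Finset.mem_filter] at ha hb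
    obtain ⟨i, ⟨hi, hSi⟩, hai⟩ := ha
    obtain ⟨j, ⟨hj, hSj⟩, hbj⟩ := hb
    rw [← max_add_add_right]
    exact (hT.dist_le_max_of_between (h3 i hi j hj hSi hSj) y).trans
      (max_le_max (hCf i a hai y) (hCf j b hbj y))

/-- The observable diameter with an `ℝ`-tree as screen is controlled by the separation distance. -/
lemma obsDiam_tree_le_two_mul_sep {X : Type*} [MetricSpace X]
    [TopologicalSpace.SeparableSpace X] [MeasurableSpace X] [BorelSpace X]
    (μ : Measure X) [IsFiniteMeasure μ]
    {T : Type*} [MetricSpace T] [MeasurableSpace T] [BorelSpace T] (hT : IsRTree T)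
    (κ : ℝ≥0∞) (hκ0 : 0 < κ) :
    obsDiam T μ κ ≤ 2 * sep μ (κ / 3) (κ / 3) := by
  refine iSup₂_le fun f hf => ?_
  rcases le_or_gt (μ Set.univ) κ with hle | hκ
  · refine (partialDiam_le (s := ∅) MeasurableSet.empty ?_).trans ?_
    · simp [tsub_eq_zero_of_le hle]
    · exact (Metric.ediam_empty (X := T)).trans_le zero_le
  rcases eq_or_ne (sep μ (κ / 3) (κ / 3)) ⊤ with htop | hfin
  · simp [htop]
  refine ENNReal.le_of_forall_pos_le_add fun ε hε _ => ?_
  have hδ : (0 : ℝ) < ε / 4 := by positivity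
  obtain ⟨z, A, B, hA, hB, hκA, hκB, hz⟩ := hT.exists_approx_median μ hκ0 hκ hf hδ
  set σ : ℝ := (sep μ (κ / 3) (κ / 3)).toReal
  have hσ0 : 0 ≤ σ := ENNReal.toReal_nonneg
  have hσe : sep μ (κ / 3) (κ / 3) = ENNReal.ofReal σ := (ENNReal.ofReal_toReal hfin).symm
  set r : ℝ := σ + ε / 4 with hr
  have hlt : sep μ (κ / 3) (κ / 3) < ENNReal.ofReal r := by
    rw [hσe]
    exact (ENNReal.ofReal_lt_ofReal_iff (by linarith)).2 (by linarith)
  have hYm : MeasurableSet (Metric.closedBall z (r + ε / 4)) := measurableSet_closedBall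
  have hpre : MeasurableSet (f ⁻¹' Metric.closedBall z (r + ε / 4)) := hf.continuous.measurable hYm
  have near {D : Set X} {x : X} (hx : Metric.infEDist x D < ENNReal.ofReal r) :
      ∃ a ∈ D, dist (f x) (f a) ≤ r := by
    obtain ⟨a, ha, hxa⟩ := Metric.infEDist_lt_iff.1 hx
    rw [edist_dist, ENNReal.ofReal_lt_ofReal_iff (by linarith)] at hxa
    have := hf.dist_le_mul x a
    simp only [NNReal.coe_one, one_mul] at this
    exact ⟨a, ha, this.trans hxa.le⟩
  have hcover : (f ⁻¹' Metric.closedBall z (r + ε / 4))ᶜ ⊆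
      {x | ENNReal.ofReal r ≤ Metric.infEDist x A} ∪
        {x | ENNReal.ofReal r ≤ Metric.infEDist x B} := by
    intro x hx
    by_contra hn
    simp only [Set.mem_union, Set.mem_ofPred_eq, not_or, not_le] at hn
    obtain ⟨a, ha, hxa⟩ := near hn.1
    obtain ⟨b, hb, hxb⟩ := near hn.2
    exact hx ((hz a ha b hb (f x)).trans (by gcongr; exact max_le hxa hxb))
  have hcompl : μ (f ⁻¹' Metric.closedBall z (r + ε / 4))ᶜ ≤ κ := by
    refine (measure_mono hcover).trans ((measure_union_le _ _).trans ?_)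
    calc _ ≤ κ / 3 + κ / 3 := add_le_add (measure_le_infEdist_lt_of_sep_lt hlt hA hκA).le
          (measure_le_infEdist_lt_of_sep_lt hlt hB hκB).le
      _ ≤ κ / 3 + κ / 3 + κ / 3 := le_self_add
      _ = κ := ENNReal.add_thirds κ
  have hmass : μ Set.univ - κ ≤ Measure.map f μ (Metric.closedBall z (r + ε / 4)) := by
    rw [Measure.map_apply hf.continuous.measurable hYm, tsub_le_iff_right,
      ← measure_add_measure_compl hpre]
    gcongr
  refine (partialDiam_le hYm hmass).trans ?_
  refine Metric.ediam_le fun x hx y hy => ?_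
  rw [edist_dist, hσe, ← ENNReal.ofReal_coe_nnreal, ← ENNReal.ofReal_ofNat,
    ← ENNReal.ofReal_mul (by norm_num), ← ENNReal.ofReal_add (by positivity) (by positivity)]
  apply ENNReal.ofReal_le_ofReal
  have := dist_triangle_right x y z
  have := Metric.mem_closedBall.1 hx
  have := Metric.mem_closedBall.1 hy
  linarith

/-- For an mm-space `X`, an `ℝ`-tree `T` and any `κ > 0`,
`ObsDiam_T(X; -κ) ≤ 2 Sep(X; κ/3, κ/3) + 4 ObsDiam_ℝ(X; -κ)`. -/
theorem obsDiam_tree_le {X : Type*} [MetricSpace X] [CompleteSpace X]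
    [TopologicalSpace.SeparableSpace X] [MeasurableSpace X] [BorelSpace X]
    (μ : Measure X) [IsFiniteMeasure μ]
    {T : Type*} [MetricSpace T] [MeasurableSpace T] [BorelSpace T] (hT : IsRTree T)
    (κ : ℝ≥0∞) (hκ0 : 0 < κ) (hκ : κ ≠ ⊤) :
    obsDiam T μ κ ≤ 2 * sep μ (κ / 3) (κ / 3) + 4 * obsDiam ℝ μ κ :=
  (obsDiam_tree_le_two_mul_sep μ hT κ hκ0).trans le_self_add
end

section
/- Let {X_n} be a sequence of mm-spaces. Then ObsDiam_ℝ(X_n; −κ) → 0 as n → ∞ for every κ > 0 if and only if sup{ ObsDiam_T(X_n; −κ) : T is an ℝ-tree } → 0 as n → ∞ for every κ > 0. -/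
open MeasureTheory ENNReal

universe u v

theorem exists_preimage_of_obsDiam_lt {X Y : Type*} [MetricSpace X] [MeasurableSpace X]
    [BorelSpace X] [MetricSpace Y] [MeasurableSpace Y] [BorelSpace Y] {μ : Measure X}
    {κ : ℝ≥0∞} {δ : ℝ} (h : obsDiam Y μ κ < ENNReal.ofReal δ) {f : X → Y}
    (hf : LipschitzWith 1 f) :
    ∃ s : Set Y, MeasurableSet s ∧ (∀ a ∈ s, ∀ b ∈ s, dist a b < δ) ∧
      μ Set.univ - κ ≤ μ (f ⁻¹' s) := by
  have h1 : partialDiam (Measure.map f μ) (μ Set.univ - κ) < ENNReal.ofReal δ :=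
    lt_of_le_of_lt (le_iSup₂ (f := fun (f : X → Y) (_ : LipschitzWith 1 f) =>
      partialDiam (Measure.map f μ) (μ Set.univ - κ)) f hf) h
  simp only [partialDiam, iInf_lt_iff] at h1
  obtain ⟨s, hs, hμ, hd⟩ := h1
  rw [Measure.map_apply hf.continuous.measurable hs] at hμ
  refine ⟨s, hs, fun a ha b hb => ?_, hμ⟩
  have h2 := (Metric.edist_le_ediam_of_mem ha hb).trans_lt hd
  rw [edist_dist] at h2
  exact (ENNReal.ofReal_lt_ofReal_iff'.1 h2).1

theorem inter_nonempty_of_univ_sub_le {X : Type*} [MeasurableSpace X] {μ : Measure X}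
    [IsFiniteMeasure μ] {κ : ℝ≥0∞} {s A : Set X} (hs : MeasurableSet s)
    (h : μ Set.univ - κ ≤ μ s) (hA : κ < μ A) : (s ∩ A).Nonempty := by
  by_contra hne
  have hd : Disjoint s A := Set.disjoint_iff_inter_eq_empty.2 (Set.not_nonempty_iff_eq_empty.1 hne)
  have h1 : μ s + μ A ≤ μ Set.univ := by
    rw [← measure_union' hd hs]
    exact measure_mono (Set.subset_univ _)
  have h2 : μ Set.univ ≤ μ s + κ := tsub_le_iff_right.1 h
  exact absurd (h1.trans h2) (not_le.2 ((ENNReal.add_lt_add_iff_left (measure_ne_top μ s)).2 hA))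

/-- If the real observable diameter is small, then of two sets at definite distance from each
other one has small measure. -/
theorem measure_le_of_obsDiam_real_lt {X : Type*} [MetricSpace X] [MeasurableSpace X]
    [BorelSpace X] {μ : Measure X} [IsFiniteMeasure μ] {κ : ℝ≥0∞} {δ : ℝ}
    (h : obsDiam ℝ μ κ < ENNReal.ofReal δ) {A B : Set X} (hA : κ < μ A)
    (hsep : ∀ x ∈ A, ∀ y ∈ B, δ ≤ dist x y) : μ B ≤ κ := by
  by_contra! hB
  obtain ⟨J, hJm, hJ, hJμ⟩ := exists_preimage_of_obsDiam_lt h (Metric.lipschitz_infDist_pt A)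
  have hm := (Metric.lipschitz_infDist_pt A).continuous.measurable hJm
  obtain ⟨x, hxJ, hxA⟩ := inter_nonempty_of_univ_sub_le hm hJμ hA
  obtain ⟨y, hyJ, hyB⟩ := inter_nonempty_of_univ_sub_le hm hJμ hB
  have h1 : dist (Metric.infDist y A) (Metric.infDist x A) < δ := hJ _ hyJ _ hxJ
  rw [Metric.infDist_zero_of_mem hxA, Real.dist_eq, sub_zero] at h1
  have h2 : δ ≤ Metric.infDist y A := (Metric.le_infDist ⟨x, hxA⟩).2 fun z hz => by
    rw [dist_comm]; exact hsep z hz y hyB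
  exact absurd (lt_of_le_of_lt (le_abs_self _) h1) (not_lt.2 h2)

/-- In a `0`-hyperbolic space the observable diameter is controlled by the real one. The space is
cut into an annulus around a base point, which is then partitioned by the Gromov product. -/
theorem obsDiam_le_of_zero_hyperbolic {X T : Type*} [MetricSpace X]
    [TopologicalSpace.SeparableSpace X] [MeasurableSpace X] [BorelSpace X]
    [MetricSpace T] [MeasurableSpace T] [BorelSpace T] {μ : Measure X} [IsFiniteMeasure μ]
    (hT : ∀ x y z w : T,
      dist x y + dist z w ≤ max (dist x z + dist y w) (dist x w + dist y z))
    {κ : ℝ≥0∞} {δ : ℝ} (hδ : 0 < δ) (h : obsDiam ℝ μ κ < ENNReal.ofReal δ) :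
    obsDiam T μ (4 * κ) ≤ ENNReal.ofReal (6 * δ) := by
  refine iSup₂_le fun f hf => ?_
  have hfm := hf.continuous.measurable
  rcases le_or_gt (μ Set.univ) (4 * κ) with hm | hm
  · refine (iInf₂_le_of_le ∅ MeasurableSet.empty (iInf_le_of_le ?_ le_rfl)).trans ?_
    · simp [tsub_eq_zero_of_le hm]
    · exact Metric.ediam_empty.trans_le bot_le
  have hX : Nonempty X := by
    by_contra hX
    rw [not_nonempty_iff] at hX
    simp [Measure.eq_zero_of_isEmpty μ] at hm
  set q := TopologicalSpace.denseSeq X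
  set o : T := f (q 0)
  have hκ : κ < μ Set.univ - κ := by
    rw [lt_tsub_iff_right]
    refine lt_of_le_of_lt ?_ hm
    rw [← two_mul]
    gcongr
    norm_num
  have hg : LipschitzWith 1 fun x => dist o (f x) := by
    simpa [Function.comp_def] using (LipschitzWith.dist_right o).comp hf
  obtain ⟨I, hIm, hI, hIμ⟩ := exists_preimage_of_obsDiam_lt h hg
  obtain ⟨x₀, hx₀⟩ : ((fun x => dist o (f x)) ⁻¹' I).Nonempty :=
    nonempty_of_measure_ne_zero (bot_le.trans_lt (hκ.trans_le hIμ)).ne'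
  set p := dist o (f x₀)
  set S : Set T := {t | dist o t ∈ Set.Icc (p - δ) (p + δ)}
  have hS : μ Set.univ - κ ≤ μ (f ⁻¹' S) := by
    refine hIμ.trans (measure_mono fun x hx => ?_)
    have h1 := hI _ hx _ hx₀
    rw [Real.dist_eq, abs_lt] at h1
    exact ⟨by linarith [h1.1], by linarith [h1.2]⟩
  set C : ℕ → Set T := fun i =>
    S ∩ {t | 2 * (p - 2 * δ) ≤ dist o t + dist o (f (q i)) - dist t (f (q i))}
  have hCm : ∀ i, MeasurableSet (C i) := fun i => by
    refine IsClosed.measurableSet (IsClosed.inter (isClosed_Icc.preimage (by fun_prop)) ?_)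
    exact isClosed_le (by fun_prop) (by fun_prop)
  set A : ℕ → Set X := fun k => ⋃ i ∈ Finset.range k, f ⁻¹' C i
  have hAmono : Monotone A := fun a b hab =>
    Set.biUnion_subset_biUnion_left fun i hi => by
      simp only [Finset.coe_range, Set.mem_Iio] at hi ⊢
      omega
  have hcover : f ⁻¹' S ⊆ ⋃ k, A k := fun x hx => by
    obtain ⟨i, hi⟩ := (TopologicalSpace.denseRange_denseSeq X).exists_dist_lt x
      (show 0 < δ from hδ)
    refine Set.mem_iUnion.2 ⟨i + 1, Set.mem_biUnion (Finset.self_mem_range_succ i) ⟨hx, ?_⟩⟩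
    have h1 : dist (f x) (f (q i)) < δ := lt_of_le_of_lt (by simpa using hf.dist_le_mul x (q i)) hi
    have h2 := dist_triangle_right o (f x) (f (q i))
    have h3 : p - δ ≤ dist o (f x) := hx.1
    show 2 * (p - 2 * δ) ≤ dist o (f x) + dist o (f (q i)) - dist (f x) (f (q i))
    linarith
  have hex : ∃ k, κ < μ (A k) := by
    have h1 : κ < μ (⋃ k, A k) := hκ.trans_le (hS.trans (measure_mono hcover))
    rwa [hAmono.measure_iUnion, lt_iSup_iff] at h1
  classical
  obtain ⟨k, hk, hk'⟩ : ∃ k, μ (A k) ≤ κ ∧ κ < μ (A (k + 1)) := by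
    rcases hn : Nat.find hex with _ | k
    · have := Nat.find_spec hex
      rw [hn] at this
      simp [A] at this
    · exact ⟨k, not_lt.1 (Nat.find_min hex (by omega)), hn ▸ Nat.find_spec hex⟩
  have hB : μ (f ⁻¹' S \ A (k + 1)) ≤ κ := by
    refine measure_le_of_obsDiam_real_lt h hk' fun x hx y hy => ?_
    obtain ⟨i, hi, hxS, hxi⟩ := Set.mem_iUnion₂.1 hx
    have hyi : dist o (f y) + dist o (f (q i)) - dist (f y) (f (q i)) < 2 * (p - 2 * δ) := by
      by_contra! hyi
      exact hy.2 (Set.mem_biUnion hi ⟨hy.1, hyi⟩)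
    simp only [Set.mem_ofPred_eq] at hxi
    have hxy : dist (f x) (f y) ≤ dist x y := by simpa using hf.dist_le_mul x y
    have h1 : p - δ ≤ dist o (f x) := hxS.1
    have h2 : p - δ ≤ dist o (f y) := hy.1.1
    have h4 := hT (f y) (f (q i)) (f x) o
    rw [dist_comm (f y) (f x), dist_comm (f x) o, dist_comm (f (q i)) o, dist_comm (f y) o,
      dist_comm (f (q i)) (f x)] at h4
    rcases le_max_iff.1 h4 with h4 | h4 <;> linarith
  have hC : μ Set.univ - 4 * κ ≤ μ (f ⁻¹' C k) := by
    have hsub : f ⁻¹' S ⊆ (A k ∪ f ⁻¹' C k) ∪ (f ⁻¹' S \ A (k + 1)) := fun x hx => by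
      by_cases hxA : x ∈ A (k + 1)
      · left
        simp only [A, Finset.range_add_one, Finset.set_biUnion_insert] at hxA
        exact hxA.symm
      · exact Or.inr ⟨hx, hxA⟩
    have h1 : μ (f ⁻¹' S) ≤ κ + μ (f ⁻¹' C k) + κ :=
      (measure_mono hsub).trans <| (measure_union_le _ _).trans <|
        add_le_add ((measure_union_le _ _).trans (add_le_add hk le_rfl)) hB
    rw [tsub_le_iff_right]
    calc μ Set.univ ≤ κ + μ (f ⁻¹' C k) + κ + κ := tsub_le_iff_right.1 (hS.trans h1)
      _ = μ (f ⁻¹' C k) + 3 * κ := by ring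
      _ ≤ μ (f ⁻¹' C k) + 4 * κ := by gcongr; norm_num
  refine (iInf₂_le_of_le (C k) (hCm k) (iInf_le_of_le ?_ le_rfl)).trans ?_
  · rwa [Measure.map_apply hfm (hCm k)]
  refine Metric.ediam_le fun x hx y hy => ?_
  rw [edist_dist]
  refine ENNReal.ofReal_le_ofReal ?_
  obtain ⟨⟨-, hx1⟩, hx2⟩ := hx
  obtain ⟨⟨-, hy1⟩, hy2⟩ := hy
  simp only [Set.mem_ofPred_eq] at hx2 hy2
  have h4 := hT x y (f (q k)) o
  rw [dist_comm x o, dist_comm y o, dist_comm (f (q k)) o] at h4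
  rcases le_max_iff.1 h4 with h4 | h4 <;> linarith

theorem IsRTree.of_isometryEquiv_real {T : Type*} [MetricSpace T] (e : ℝ ≃ᵢ T) : IsRTree T := by
  refine ⟨e.completeSpace_iff.1 inferInstance, fun z w => ?_, fun x y z w => ?_⟩
  · have hd : dist z w = |e.symm z - e.symm w| := by
      rw [← e.symm.dist_eq, Real.dist_eq]
    rcases le_total (e.symm z) (e.symm w) with hle | hle
    · refine ⟨fun t => e (e.symm z + t), by simp, ?_, fun s _ t _ => ?_⟩
      · rw [hd, abs_of_nonpos (by linarith)]; simp
      · rw [e.dist_eq, Real.dist_eq]; congr 1; ring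
    · refine ⟨fun t => e (e.symm z - t), by simp, ?_, fun s _ t _ => ?_⟩
      · rw [hd, abs_of_nonneg (by linarith)]; simp
      · rw [e.dist_eq, Real.dist_eq, abs_sub_comm s t]; congr 1; ring
  · simp only [← e.symm.dist_eq, Real.dist_eq]
    generalize e.symm x = a, e.symm y = b, e.symm z = c, e.symm w = d
    rw [le_max_iff]
    by_contra! hlt
    obtain ⟨h1, h2⟩ := hlt
    rcases abs_cases (a - b) with h | h <;> rcases abs_cases (c - d) with h' | h' <;>
      linarith [le_abs_self (a - c), neg_abs_le (a - c), le_abs_self (b - d), neg_abs_le (b - d),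
        le_abs_self (a - d), neg_abs_le (a - d), le_abs_self (b - c), neg_abs_le (b - c)]

theorem obsDiam_le_of_isometryEquiv {X Y Z : Type*} [MetricSpace X] [MeasurableSpace X]
    [BorelSpace X] [MetricSpace Y] [MeasurableSpace Y] [BorelSpace Y] [MetricSpace Z]
    [MeasurableSpace Z] [BorelSpace Z] (e : Y ≃ᵢ Z) (μ : Measure X) (κ : ℝ≥0∞) :
    obsDiam Y μ κ ≤ obsDiam Z μ κ := by
  refine iSup₂_le fun f hf => ?_
  have hef : LipschitzWith 1 (e ∘ f) := by simpa using e.isometry.lipschitz.comp hf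
  refine le_trans ?_ (le_iSup₂ (f := fun (f : X → Z) (_ : LipschitzWith 1 f) =>
      partialDiam (Measure.map f μ) (μ Set.univ - κ)) (e ∘ f) hef)
  refine le_iInf₂ fun s hs => le_iInf fun hμ => ?_
  have hes : MeasurableSet (e ⁻¹' s) := e.continuous.measurable hs
  rw [Measure.map_apply hef.continuous.measurable hs] at hμ
  refine (iInf₂_le_of_le (e ⁻¹' s) hes (iInf_le_of_le ?_ le_rfl)).trans ?_
  · rwa [Measure.map_apply hf.continuous.measurable hes]
  · exact (e.ediam_preimage s).le


/-- For a sequence of mm-spaces, `ObsDiam_ℝ(X_n; -κ) → 0` for every `κ > 0`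
iff `sup { ObsDiam_T(X_n; -κ) : T an ℝ-tree } → 0` for every `κ > 0`. -/
theorem obsDiam_real_tendsto_iff_tree (X : ℕ → Type u)
    [∀ n, MetricSpace (X n)] [∀ n, CompleteSpace (X n)]
    [∀ n, TopologicalSpace.SeparableSpace (X n)]
    [∀ n, MeasurableSpace (X n)] [∀ n, BorelSpace (X n)]
    (μ : ∀ n, Measure (X n)) [∀ n, IsFiniteMeasure (μ n)] :
    (∀ κ : ℝ≥0∞, 0 < κ → κ ≠ ⊤ →
        Filter.Tendsto (fun n => obsDiam ℝ (μ n) κ) Filter.atTop (nhds 0))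
      ↔
    (∀ κ : ℝ≥0∞, 0 < κ → κ ≠ ⊤ → ∀ ε : ℝ≥0∞, 0 < ε → ∃ N : ℕ, ∀ n ≥ N,
        ∀ (T : Type v) [MetricSpace T] [MeasurableSpace T] [BorelSpace T],
          IsRTree T → obsDiam T (μ n) κ ≤ ε) := by
  constructor
  · intro h κ hκ hκ' ε hε
    obtain ⟨η, hη, hηε⟩ := ENNReal.lt_iff_exists_real_btwn.1 hε |>.imp fun η hη => hη.2
    have hη0 : 0 < η := ENNReal.ofReal_pos.1 hη
    have hδ : 0 < ENNReal.ofReal (η / 6) := ENNReal.ofReal_pos.2 (by positivity)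
    have hev := (h (κ / 4) (ENNReal.div_pos hκ.ne' (by norm_num))
      (ENNReal.div_ne_top hκ' (by norm_num))).eventually (gt_mem_nhds hδ)
    obtain ⟨N, hN⟩ := Filter.eventually_atTop.1 hev
    refine ⟨N, fun n hn T _ _ _ hT => ?_⟩
    have hle := obsDiam_le_of_zero_hyperbolic hT.2.2 (by positivity) (hN n hn)
    rw [ENNReal.mul_div_cancel (by norm_num) (by norm_num)] at hle
    refine hle.trans (le_of_eq_of_le ?_ hηε.le)
    congr 1
    ring
  · intro h κ hκ hκ'
    rw [ENNReal.tendsto_nhds_zero]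
    intro ε hε
    obtain ⟨N, hN⟩ := h κ hκ hκ' ε hε
    filter_upwards [Filter.eventually_ge_atTop N] with n hn
    let _ : MeasurableSpace (ULift.{v} ℝ) := borel _
    have _ : BorelSpace (ULift.{v} ℝ) := ⟨rfl⟩
    let e : ℝ ≃ᵢ ULift.{v} ℝ := ⟨Equiv.ulift.symm, fun _ _ => rfl⟩
    exact (obsDiam_le_of_isometryEquiv e (μ n) κ).trans
      (hN n hn _ (IsRTree.of_isometryEquiv_real e))
end

section
/- Let X be an mm-space with total mass m = μ_X(X) whose measure μ_X has finite first moment, and let T be an ℝ-tree such that for every 1-Lipschitz map f : X → T the push-forward measure f_*(μ_X) has a center of mass. Then for any κ > 0, ObsCRad_T(X; −κ) ≤ ObsCRad_ℝ(X; −κ) + 2·Sep(X; m/3, κ/2) + Sep(X; m−κ, m−κ). -/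
open MeasureTheory ENNReal

open Filter Topology

/-- A weak form of Ekeland's variational principle. -/
theorem exists_forall_le_add_mul_dist {α : Type*} [MetricSpace α] [CompleteSpace α] [Nonempty α]
    {F : α → ℝ} (hF : Continuous F) (hF0 : ∀ x, 0 ≤ F x) {δ : ℝ} (hδ : 0 < δ) :
    ∃ z, ∀ p, F z ≤ F p + δ * dist z p := by
  have trans : ∀ x y q, F y + δ * dist x y ≤ F x → F q + δ * dist y q ≤ F y →
      F q + δ * dist x q ≤ F x := by
    intro x y q hxy hyq
    nlinarith [dist_triangle x y q]
  have almost : ∀ (n : ℕ) (x : α), ∃ p, F p + δ * dist x p ≤ F x ∧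
      ∀ q, F q + δ * dist x q ≤ F x → F p ≤ F q + (1 / 2) ^ n := by
    intro n x
    set S : Set ℝ := F '' {q | F q + δ * dist x q ≤ F x}
    have hne : S.Nonempty := ⟨F x, x, by simp, rfl⟩
    have hbdd : BddBelow S := ⟨0, by rintro _ ⟨q, -, rfl⟩; exact hF0 q⟩
    obtain ⟨_, ⟨p, hp, rfl⟩, hlt⟩ := exists_lt_of_csInf_lt hne
      (lt_add_of_pos_right (sInf S) (by positivity : (0 : ℝ) < (1 / 2) ^ n))
    exact ⟨p, hp, fun q hq => by linarith [csInf_le hbdd ⟨q, hq, rfl⟩]⟩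
  choose g hgS hgle using almost
  obtain ⟨x₀⟩ := ‹Nonempty α›
  let u : ℕ → α := fun n => Nat.rec x₀ (fun k x => g k x) n
  have hstep : ∀ n, F (u (n + 1)) + δ * dist (u n) (u (n + 1)) ≤ F (u n) := fun n => hgS n (u n)
  have hle : ∀ n q, F q + δ * dist (u n) q ≤ F (u n) → F (u (n + 1)) ≤ F q + (1 / 2) ^ n :=
    fun n q => hgle n (u n) q
  have hanti : ∀ n k, F (u (n + k)) + δ * dist (u n) (u (n + k)) ≤ F (u n) := by
    intro n k
    induction k with
    | zero => simp
    | succ k ih => exact trans _ _ _ ih (hstep (n + k))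
  have hcau : CauchySeq fun n => u (n + 1) := by
    refine cauchySeq_of_le_geometric (1 / 2) (1 / δ) (by norm_num) fun n => ?_
    have h1 := hle n _ (hanti n 2)
    have h2 := hstep (n + 1)
    rw [one_div_mul_eq_div, le_div_iff₀ hδ]
    have h3 : F (u (n + 2)) = F (u (n + 1 + 1)) := rfl
    nlinarith
  obtain ⟨z, hz⟩ := cauchySeq_tendsto_of_complete hcau
  have hzS : ∀ n, F z + δ * dist (u n) z ≤ F (u n) := by
    intro n
    have ht : Tendsto (fun k => F (u (k + 1)) + δ * dist (u n) (u (k + 1))) atTop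
        (𝓝 (F z + δ * dist (u n) z)) :=
      ((hF.tendsto z).comp hz).add ((tendsto_const_nhds.dist hz).const_mul δ)
    refine le_of_tendsto ht ?_
    filter_upwards [eventually_ge_atTop n] with k hk
    obtain ⟨j, rfl⟩ := Nat.exists_eq_add_of_le hk
    exact hanti n (j + 1)
  refine ⟨z, fun p => ?_⟩
  by_contra! hp
  have hlim : F z ≤ F p + 0 := by
    refine le_of_tendsto_of_tendsto ((hF.tendsto z).comp hz)
      (tendsto_const_nhds.add (tendsto_pow_atTop_nhds_zero_of_lt_one (r := (1 / 2 : ℝ))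
        (by norm_num) (by norm_num))) (Eventually.of_forall fun n => ?_)
    exact hle n p (trans _ _ _ (hzS n) hp.le)
  have : 0 ≤ δ * dist z p := by positivity
  linarith

/-- The branch of a tree at `c` containing `w`. -/
def branch {T : Type*} [MetricSpace T] (c w : T) : Set T :=
  {y | dist y w < dist c y + dist c w}

section Branch

variable {T : Type*} [MetricSpace T]

theorem isOpen_branch (c w : T) : IsOpen (branch c w) :=
  isOpen_lt (by fun_prop) (by fun_prop)

theorem mem_branch_self {c w : T} (h : w ≠ c) : w ∈ branch c w := by
  have := dist_pos.2 h.symm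
  simp only [branch, Set.mem_ofPred_eq, dist_self]
  linarith

theorem mem_branch_comm {c w y : T} : y ∈ branch c w ↔ w ∈ branch c y := by
  simp only [branch, Set.mem_ofPred_eq, dist_comm y w, add_comm]

theorem mem_branch_trans (hT : IsRTree T) {c x y w : T} (hxy : x ∈ branch c y)
    (hyw : y ∈ branch c w) : x ∈ branch c w := by
  simp only [branch, Set.mem_ofPred_eq] at *
  have h4 := hT.2.2 x w y c
  rw [dist_comm w c, dist_comm w y, dist_comm x c, dist_comm y c] at h4
  rcases le_max_iff.1 h4 with h | h <;> linarith

/-- The geodesic between points in different branches passes through the base point. -/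
theorem dist_eq_add_of_mem_of_notMem (hT : IsRTree T) {c w x y : T} (hx : x ∈ branch c w)
    (hy : y ∉ branch c w) : dist x y = dist c x + dist c y := by
  refine le_antisymm (by rw [dist_comm c x]; exact dist_triangle x c y) ?_
  by_contra! h
  exact hy (mem_branch_trans hT (mem_branch_comm.1 h) hx)

open Classical in
/-- `1` on the branch at `c` containing `w`, and `-1` off it. -/
noncomputable def branchSign (c w y : T) : ℝ := if y ∈ branch c w then 1 else -1

theorem abs_branchSign (c w y : T) : |branchSign c w y| = 1 := by
  unfold branchSign; split_ifs <;> simp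

theorem integral_branchSign [MeasurableSpace T] [BorelSpace T] (ν : Measure T) [IsFiniteMeasure ν]
    (c w : T) : ∫ y, branchSign c w y ∂ν = 2 * ν.real (branch c w) - ν.real Set.univ := by
  have hm := (isOpen_branch c w).measurableSet
  have : branchSign c w = fun y => (branch c w).indicator (fun _ => (2 : ℝ)) y - 1 := by
    funext y
    unfold branchSign Set.indicator
    split_ifs <;> norm_num
  rw [this, integral_sub ((integrable_const _).indicator hm) (integrable_const _),
    integral_indicator hm]
  simp [mul_comm]

/-- The signed distance to `c`, positive on the branch containing `w`. -/
noncomputable def branchHeight (c w y : T) : ℝ := branchSign c w y * dist c y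

theorem lipschitzWith_branchHeight (hT : IsRTree T) (c w : T) :
    LipschitzWith 1 (branchHeight c w) := by
  refine LipschitzWith.of_dist_le_mul fun x y => ?_
  have h1 := dist_triangle c x y
  have h2 := dist_triangle c y x
  rw [dist_comm y x] at h2
  rw [NNReal.coe_one, one_mul, Real.dist_eq, abs_le]
  unfold branchHeight branchSign
  have d1 : 0 ≤ dist c x := dist_nonneg
  have d2 : 0 ≤ dist c y := dist_nonneg
  split_ifs with hx hy hy
  · constructor <;> linarith
  · have := dist_eq_add_of_mem_of_notMem hT hx hy
    constructor <;> linarith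
  · have := dist_eq_add_of_mem_of_notMem hT hy hx
    rw [dist_comm y x] at this
    constructor <;> linarith
  · constructor <;> linarith

theorem abs_branchHeight (c w y : T) : |branchHeight c w y| = dist c y := by
  rw [branchHeight, abs_mul, abs_branchSign, one_mul, abs_of_nonneg dist_nonneg]

theorem branchHeight_self (c w : T) : branchHeight c w w = dist c w := by
  by_cases h : w = c
  · simp [branchHeight, h]
  · simp [branchHeight, branchSign, mem_branch_self h]

/-- There are points tending to `c` along which the distance to every fixed `y` eventually
changes at unit speed, decreasing exactly when `y` lies in the branch containing `w`. -/
theorem exists_seq_dist_eventually_eq (hT : IsRTree T) {c w : T} (hw : w ≠ c) :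
    ∃ (p : ℕ → T) (t : ℕ → ℝ), (∀ n, 0 < t n) ∧ Tendsto t atTop (𝓝 0) ∧
      (∀ n, t n ≤ dist c w) ∧ (∀ n, dist c (p n) = t n) ∧
      ∀ y, ∀ᶠ n in atTop, dist (p n) y = dist c y - branchSign c w y * t n := by
  obtain ⟨γ, h0, h1, hγ⟩ := hT.2.1 c w
  have hL : 0 < dist c w := dist_pos.2 hw.symm
  let t : ℕ → ℝ := fun n => dist c w * (1 / ((n : ℝ) + 1))
  have htpos : ∀ n, 0 < t n := fun n => by positivity
  have htlim : Tendsto t atTop (𝓝 0) := by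
    simpa [t] using (tendsto_one_div_add_atTop_nhds_zero_nat (𝕜 := ℝ)).const_mul (dist c w)
  have htle : ∀ n, t n ≤ dist c w := fun n => by
    refine mul_le_of_le_one_right hL.le ?_
    rw [div_le_one (by positivity)]
    linarith [n.cast_nonneg (α := ℝ)]
  have hc : ∀ n, dist c (γ (t n)) = t n := fun n => by
    have := hγ 0 ⟨le_rfl, hL.le⟩ (t n) ⟨(htpos n).le, htle n⟩
    rwa [h0, zero_sub, abs_neg, abs_of_pos (htpos n)] at this
  have hd : ∀ n, dist (γ (t n)) w = dist c w - t n := fun n => by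
    have := hγ (t n) ⟨(htpos n).le, htle n⟩ (dist c w) ⟨hL.le, le_rfl⟩
    rwa [h1, abs_sub_comm, abs_of_nonneg (by linarith [htle n])] at this
  refine ⟨fun n => γ (t n), t, htpos, htlim, htle, hc, fun y => ?_⟩
  by_cases hy : y ∈ branch c w
  · have hpos : 0 < (dist c y + dist c w - dist y w) / 2 := by
      have : dist y w < dist c y + dist c w := hy
      linarith
    filter_upwards [htlim.eventually_lt_const hpos] with n hn
    have hs : branchSign c w y = 1 := if_pos hy
    rw [hs, one_mul]
    have h4 := hT.2.2 (γ (t n)) y c w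
    rw [dist_comm (γ (t n)) c, dist_comm y c, hc, hd] at h4
    have h5 := dist_triangle c (γ (t n)) y
    rw [hc] at h5
    rcases le_max_iff.1 h4 with h | h <;> linarith
  · refine Eventually.of_forall fun n => ?_
    have hs : branchSign c w y = -1 := if_neg hy
    have h6 := dist_eq_add_of_mem_of_notMem hT (mem_branch_self hw) hy
    have h7 := dist_triangle w (γ (t n)) y
    have h8 := dist_triangle (γ (t n)) c y
    rw [dist_comm w (γ (t n)), hd] at h7
    rw [dist_comm (γ (t n)) c, hc] at h8
    rw [hs]
    linarith

end Branch

section Measures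

variable {T : Type*} [MetricSpace T] [MeasurableSpace T] [BorelSpace T]

/-- At a center of mass, the mean signed distance in the direction of any branch is nonpositive. -/
theorem integral_branchHeight_nonpos (hT : IsRTree T) {ν : Measure T} [IsFiniteMeasure ν]
    (hint : ∀ x, Integrable (fun y => dist x y) ν) {c w : T} (hc : IsCenterOfMass ν c)
    (hw : w ≠ c) : ∫ y, branchHeight c w y ∂ν ≤ 0 := by
  obtain ⟨p, t, ht0, htlim, htle, hpt, hev⟩ := exists_seq_dist_eventually_eq hT hw
  have hlim : Tendsto (fun n => ∫ y, (dist (p n) y ^ 2 - dist c y ^ 2) / t n ∂ν) atTop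
      (𝓝 (∫ y, -2 * branchHeight c w y ∂ν)) := by
    refine tendsto_integral_of_dominated_convergence (fun y => 2 * dist c y + dist c w)
      (fun n => ?_) (((hint c).const_mul 2).add (integrable_const _)) (fun n => ?_) ?_
    · exact (Continuous.measurable (by fun_prop)).aestronglyMeasurable
    · refine Eventually.of_forall fun y => ?_
      have h1 := abs_dist_sub_le (p n) c y
      rw [dist_comm (p n) c, hpt] at h1
      have h2 := dist_triangle (p n) c y
      rw [dist_comm (p n) c, hpt] at h2
      rw [Real.norm_eq_abs, abs_div, abs_of_pos (ht0 n), div_le_iff₀ (ht0 n), sq_sub_sq, abs_mul,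
        abs_of_nonneg (a := dist (p n) y + dist c y) (by positivity)]
      exact mul_le_mul (by linarith [htle n]) h1 (abs_nonneg _) (by positivity)
    · refine Eventually.of_forall fun y => ?_
      have hs : branchSign c w y ^ 2 = 1 := by rw [← sq_abs, abs_branchSign, one_pow]
      have hl : Tendsto (fun n => -2 * branchHeight c w y + t n) atTop
          (𝓝 (-2 * branchHeight c w y)) := by
        simpa using tendsto_const_nhds.add htlim
      refine hl.congr' ?_
      filter_upwards [hev y] with n hn
      rw [hn, eq_div_iff (ht0 n).ne', branchHeight]
      linear_combination (- t n ^ 2) * hs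
  have h0 : 0 ≤ ∫ y, -2 * branchHeight c w y ∂ν := by
    refine ge_of_tendsto' hlim fun n => ?_
    have hne : p n ≠ c := fun h => by simpa [h] using (hpt n).trans_gt (ht0 n)
    have := hc c (p n) hne
    simp only [sub_self, integral_zero] at this
    rw [integral_div]
    exact div_nonneg this.le (ht0 n).le
  rw [integral_const_mul] at h0
  linarith

/-- A point where the mean distance function decreases at rate at most `δ` has no branch
heavier than `(m + δ) / 2`. -/
theorem measureReal_branch_le (hT : IsRTree T) {ν : Measure T} [IsFiniteMeasure ν]
    (hint : ∀ x, Integrable (fun y => dist x y) ν) {z w : T} {δ : ℝ}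
    (hz : ∀ p, ∫ y, dist z y ∂ν ≤ ∫ y, dist p y ∂ν + δ * dist z p) (hw : w ≠ z) :
    2 * ν.real (branch z w) ≤ ν.real Set.univ + δ := by
  obtain ⟨p, t, ht0, -, -, hpt, hev⟩ := exists_seq_dist_eventually_eq hT hw
  have hlim : Tendsto (fun n => ∫ y, (dist (p n) y - dist z y) / t n ∂ν) atTop
      (𝓝 (∫ y, -branchSign z w y ∂ν)) := by
    refine tendsto_integral_of_dominated_convergence (fun _ => 1)
      (fun n => ?_) (integrable_const _) (fun n => ?_) ?_
    · exact (Continuous.measurable (by fun_prop)).aestronglyMeasurable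
    · refine Eventually.of_forall fun y => ?_
      have h1 := abs_dist_sub_le (p n) z y
      rw [dist_comm (p n) z, hpt] at h1
      rwa [Real.norm_eq_abs, abs_div, abs_of_pos (ht0 n), div_le_one (ht0 n)]
    · refine Eventually.of_forall fun y => tendsto_const_nhds.congr' ?_
      filter_upwards [hev y] with n hn
      rw [hn, eq_div_iff (ht0 n).ne']
      ring
  have h0 : -δ ≤ ∫ y, -branchSign z w y ∂ν := by
    refine ge_of_tendsto' hlim fun n => ?_
    rw [integral_div, integral_sub (hint _) (hint _), le_div_iff₀ (ht0 n)]
    have := hz (p n)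
    rw [hpt] at this
    linarith
  rw [integral_neg, integral_branchSign] at h0
  linarith

/-- Existence of a median: some point `z` splits the tree into two sets of measure at least a
third of the total mass, such that geodesics from one to the other pass through `z`. -/
theorem exists_median_split (hT : IsRTree T) [Nonempty T] {ν : Measure T} [IsFiniteMeasure ν]
    (hint : ∀ x, Integrable (fun y => dist x y) ν) (hsep : HasSeparableSupport ν)
    (hν : 0 < ν.real Set.univ) :
    ∃ (z : T) (U : Set T), IsOpen U ∧ (∀ x ∈ U, ∀ y ∉ U, dist x y = dist z x + dist z y) ∧
      ν.real Set.univ / 3 ≤ ν.real (insert z U) ∧ ν.real Set.univ / 3 ≤ ν.real Uᶜ := by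
  have := hT.1
  set m := ν.real Set.univ with hm
  have hF : Continuous fun x => ∫ y, dist x y ∂ν := by
    refine (LipschitzWith.of_dist_le_mul (K := ⟨m, hν.le⟩) fun x x' => ?_).continuous
    rw [Real.dist_eq, ← integral_sub (hint _) (hint _), ← Real.norm_eq_abs, mul_comm]
    exact norm_integral_le_of_norm_le_const (Eventually.of_forall fun y => abs_dist_sub_le x x' y)
  obtain ⟨z, hz⟩ := exists_forall_le_add_mul_dist hF
    (fun x => integral_nonneg fun y => dist_nonneg) (δ := m / 3) (by positivity)
  have hbr : ∀ w, ν.real (branch z w) ≤ 2 * m / 3 := by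
    intro w
    by_cases hw : w = z
    · have : branch z w = ∅ := by
        ext y; simp [branch, hw, dist_comm]
      rw [this, measureReal_empty]
      positivity
    · linarith [measureReal_branch_le hT hint hz hw]
  obtain ⟨s, ⟨D, hD, hsD⟩, hs⟩ := hsep
  have hDne : D.Nonempty := by
    by_contra h
    rw [Set.not_nonempty_iff_eq_empty] at h
    rw [h, closure_empty, Set.subset_empty_iff] at hsD
    rw [hsD, Set.compl_empty] at hs
    simp [hm, Measure.real, hs] at hν
  obtain ⟨d, rfl⟩ := hD.exists_eq_range hDne
  let U : ℕ → Set T := fun n => ⋃ i, ⋃ _ : i < n, branch z (d i)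
  have hUo : ∀ n, IsOpen (U n) := fun n =>
    isOpen_iUnion fun i => isOpen_iUnion fun _ => isOpen_branch _ _
  have hUs : ∀ n, U (n + 1) = U n ∪ branch z (d n) := fun n => Set.biUnion_lt_succ _ n
  have hUd : ∀ n, ∀ x ∈ U n, ∀ y ∉ U n, dist x y = dist z x + dist z y := by
    intro n x hx y hy
    simp only [U, Set.mem_iUnion, not_exists] at hx hy
    obtain ⟨i, hi, hxi⟩ := hx
    exact dist_eq_add_of_mem_of_notMem hT hxi (hy i hi)
  have hmono : Monotone fun n => insert z (U n) := fun a b hab =>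
    Set.insert_subset_insert (Set.biUnion_subset_biUnion_left fun i hi => lt_of_lt_of_le hi hab)
  have hcover : s ⊆ ⋃ n, insert z (U n) := by
    intro y hy
    by_cases hyz : y = z
    · exact Set.mem_iUnion.2 ⟨0, Or.inl hyz⟩
    · obtain ⟨_, hmem, i, rfl⟩ := mem_closure_iff.1 (hsD hy) _ (isOpen_branch z y)
        (mem_branch_self hyz)
      exact Set.mem_iUnion.2 ⟨i + 1, Or.inr (Set.mem_biUnion (Nat.lt_succ_self i)
        (mem_branch_comm.1 hmem))⟩
  have hfull : ν (⋃ n, insert z (U n)) = ν Set.univ := by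
    refine le_antisymm (measure_mono (Set.subset_univ _)) ?_
    calc ν Set.univ = ν (s ∪ sᶜ) := by rw [Set.union_compl_self]
      _ ≤ ν s + ν sᶜ := measure_union_le _ _
      _ = ν s := by rw [hs, add_zero]
      _ ≤ _ := measure_mono hcover
  have hlim : Tendsto (fun n => ν.real (insert z (U n))) atTop (𝓝 m) := by
    have := tendsto_measure_iUnion_atTop (μ := ν) hmono
    rw [hfull] at this
    exact (ENNReal.tendsto_toReal (measure_ne_top _ _)).comp this
  have hex : ∃ n, m / 3 ≤ ν.real (insert z (U n)) :=
    (hlim.eventually_const_le (by linarith)).exists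
  classical
  have hn := Nat.find_spec hex
  rcases hk : Nat.find hex with _ | k
  · rw [hk] at hn
    refine ⟨z, U 0, hUo 0, hUd 0, hn, ?_⟩
    have hU0 : U 0 = ∅ := by simp [U]
    rw [hU0, Set.compl_empty]
    linarith
  · have hlt : ν.real (insert z (U k)) < m / 3 := not_le.1 (Nat.find_min hex (by omega))
    rw [hk] at hn
    by_cases hb : m / 3 ≤ ν.real (branch z (d k))
    · refine ⟨z, branch z (d k), isOpen_branch _ _,
        fun x hx y hy => dist_eq_add_of_mem_of_notMem hT hx hy,
        hb.trans (measureReal_mono (Set.subset_insert _ _)), ?_⟩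
      rw [measureReal_compl (isOpen_branch _ _).measurableSet]
      linarith [hbr (d k)]
    · refine ⟨z, U (k + 1), hUo _, hUd _, hn, ?_⟩
      rw [measureReal_compl (hUo _).measurableSet, hUs]
      have h1 := measureReal_union_le (μ := ν) (U k) (branch z (d k))
      have h2 : ν.real (U k) ≤ ν.real (insert z (U k)) :=
        measureReal_mono (Set.subset_insert _ _)
      linarith

end Measures

/-- The mean of an integrable measure on the line is its center of mass. -/
theorem isCenterOfMass_real {ν : Measure ℝ} [IsFiniteMeasure ν] (hν : 0 < ν.real Set.univ)
    (hint : Integrable (fun y => y) ν) :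
    IsCenterOfMass ν ((∫ y, y ∂ν) / ν.real Set.univ) := by
  set b := (∫ y, y ∂ν) / ν.real Set.univ with hb
  intro z x hx
  have key : ∀ a : ℝ, ∫ y, (dist a y ^ 2 - dist z y ^ 2) ∂ν
      = (a ^ 2 - z ^ 2) * ν.real Set.univ - 2 * (a - z) * (b * ν.real Set.univ) := by
    intro a
    have : ∀ y, dist a y ^ 2 - dist z y ^ 2 = (a ^ 2 - z ^ 2) - 2 * (a - z) * y := fun y => by
      rw [Real.dist_eq, Real.dist_eq, sq_abs, sq_abs]; ring
    simp_rw [this]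
    rw [integral_sub (integrable_const _) (hint.const_mul _), integral_const_mul, integral_const,
      hb, div_mul_cancel₀ _ hν.ne', smul_eq_mul, mul_comm]
  rw [key, key]
  nlinarith [mul_pos hν (sq_pos_of_ne_zero (sub_ne_zero.2 hx))]

section Separation

variable {α : Type*} [MetricSpace α] [MeasurableSpace α]

theorem le_sep {μ : Measure α} {κ₁ κ₂ r : ℝ≥0∞} {A B : Set α} (hA : MeasurableSet A)
    (hB : MeasurableSet B) (h₁ : κ₁ ≤ μ A) (h₂ : κ₂ ≤ μ B)
    (h : ∀ x ∈ A, ∀ y ∈ B, r ≤ edist x y) : r ≤ sep μ κ₁ κ₂ := by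
  unfold sep
  refine le_iSup_of_le A (le_iSup_of_le B (le_iSup_of_le hA (le_iSup_of_le hB
    (le_iSup_of_le h₁ (le_iSup_of_le h₂ ?_)))))
  exact le_iInf₂ fun x hx => Metric.le_infEDist.2 fun y hy => h x hx y hy

theorem cRad_le_ofReal {ν : Measure α} {c : α} {a : ℝ≥0∞} {ρ : ℝ} (hρ : 0 < ρ)
    (h : a ≤ ν (Metric.closedBall c ρ)) : cRad ν c a ≤ ENNReal.ofReal ρ := by
  refine sInf_le ⟨ENNReal.ofReal_pos.2 hρ, ?_⟩
  change a ≤ ν (Metric.closedEBall c _)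
  rwa [Metric.closedEBall_ofReal hρ.le]

theorem le_measure_closedBall_of_cRad_lt {ν : Measure α} {c : α} {a : ℝ≥0∞} {ρ : ℝ}
    (h : cRad ν c a < ENNReal.ofReal ρ) : a ≤ ν (Metric.closedBall c ρ) := by
  obtain ⟨r, ⟨-, hr⟩, hlt⟩ := sInf_lt_iff.1 h
  have hρ : 0 < ρ := ENNReal.ofReal_pos.1 (bot_le.trans_lt h)
  rw [← Metric.closedEBall_ofReal hρ.le]
  exact hr.trans (measure_mono (Metric.closedEBall_subset_closedEBall hlt.le))

variable [BorelSpace α] {T : Type*} [MetricSpace T] [MeasurableSpace T] [BorelSpace T]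

/-- If a point `z` splits `T` into two parts of pushforward measure at least `a`, then all but `κ`
of the mass lies within `Sep(μ; a, κ/2)` of `z`. -/
theorem sub_le_measure_closedBall_of_split {μ : Measure α} {f : α → T} (hf : LipschitzWith 1 f)
    {z : T} {U : Set T} (hU : IsOpen U)
    (hd : ∀ x ∈ U, ∀ y ∉ U, dist x y = dist z x + dist z y) {a κ : ℝ≥0∞}
    (h₁ : a ≤ Measure.map f μ (insert z U)) (h₂ : a ≤ Measure.map f μ Uᶜ) {r : ℝ}
    (hr : sep μ a (κ / 2) < ENNReal.ofReal r) :
    μ Set.univ - κ ≤ Measure.map f μ (Metric.closedBall z r) := by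
  have hfm : Measurable f := hf.continuous.measurable
  have hr0 : 0 < r := ENNReal.ofReal_pos.1 (bot_le.trans_lt hr)
  have hd' : ∀ x ∈ insert z U, ∀ y ∉ U, dist x y = dist z x + dist z y := by
    rintro x (rfl | hx) y hy
    · simp
    · exact hd x hx y hy
  have hVm : MeasurableSet (Metric.closedBall z r)ᶜ :=
    Metric.isClosed_closedBall.measurableSet.compl
  have hIm : MeasurableSet (insert z U) := hU.measurableSet.insert z
  have hCm : MeasurableSet Uᶜ := hU.measurableSet.compl
  -- A part of `V` far from `z` is far from the other part `W`.
  have hsmall : ∀ V W : Set T, MeasurableSet V → MeasurableSet W → a ≤ Measure.map f μ W →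
      (∀ x ∈ W, ∀ y ∈ V, dist x y = dist z x + dist z y) →
      Measure.map f μ (V ∩ (Metric.closedBall z r)ᶜ) ≤ κ / 2 := by
    intro V W hV hW haW hWV
    by_contra! hlt
    refine hr.not_ge ?_
    rw [Measure.map_apply hfm hW] at haW
    rw [Measure.map_apply hfm (hV.inter hVm)] at hlt
    refine le_sep (hfm hW) (hfm (hV.inter hVm)) haW hlt.le ?_
    rintro x hx y ⟨hyV, hyr⟩
    rw [edist_dist]
    refine ENNReal.ofReal_le_ofReal ?_
    have h3 : r < dist (f y) z := by simpa using hyr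
    have h4 := hWV _ hx _ hyV
    have h5 := hf.dist_le_mul x y
    rw [NNReal.coe_one, one_mul] at h5
    rw [dist_comm] at h3
    have : 0 ≤ dist z (f x) := dist_nonneg
    linarith
  have hs₁ := hsmall Uᶜ (insert z U) hCm hIm h₁ hd'
  have hs₂ := hsmall (insert z U) Uᶜ hIm hCm h₂ fun x hx y hy => by
    rw [dist_comm, hd' y hy x hx, add_comm]
  rw [tsub_le_iff_right, ← Set.preimage_univ (f := f), ← Measure.map_apply hfm MeasurableSet.univ]
  have hcov : (Set.univ : Set T) ⊆ Metric.closedBall z r ∪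
      ((Uᶜ ∩ (Metric.closedBall z r)ᶜ) ∪ (insert z U ∩ (Metric.closedBall z r)ᶜ)) := by
    intro y _
    by_cases hy : y ∈ Metric.closedBall z r
    · exact Or.inl hy
    · by_cases hyU : y ∈ U
      · exact Or.inr (Or.inr ⟨Or.inr hyU, hy⟩)
      · exact Or.inr (Or.inl ⟨hyU, hy⟩)
  refine (measure_mono hcov).trans ((measure_union_le _ _).trans ?_)
  gcongr
  refine (measure_union_le _ _).trans ((add_le_add hs₁ hs₂).trans ?_)
  rw [ENNReal.add_halves]

end Separation

/-- The central radius bound for a single map, in terms of strict upper bounds `o`, `r`, `s` of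
the three quantities involved. -/
theorem cRad_map_le_ofReal {X : Type*} [MetricSpace X]
    [TopologicalSpace.SeparableSpace X] [MeasurableSpace X] [BorelSpace X]
    {μ : Measure X} [IsFiniteMeasure μ] (hmom : FiniteFirstMoment μ) (hm0 : μ Set.univ ≠ 0)
    {T : Type*} [MetricSpace T] [MeasurableSpace T] [BorelSpace T] (hT : IsRTree T)
    {f : X → T} (hf : LipschitzWith 1 f) {c : T} (hc : IsCenterOfMass (Measure.map f μ) c)
    {κ : ℝ≥0∞} {o r s : ℝ} (ho : obsCRad ℝ μ κ < ENNReal.ofReal o)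
    (hr : sep μ (μ Set.univ / 3) (κ / 2) < ENNReal.ofReal r)
    (hs : sep μ (μ Set.univ - κ) (μ Set.univ - κ) < ENNReal.ofReal s) :
    cRad (Measure.map f μ) c (μ Set.univ - κ) ≤ ENNReal.ofReal (o + 2 * r + s) := by
  have hfm : Measurable f := hf.continuous.measurable
  have hmr : 0 < μ.real Set.univ := ENNReal.toReal_pos hm0 (measure_ne_top _ _)
  obtain ⟨x₀, hx₀⟩ := hmom
  have hX : Integrable (fun x => dist x₀ x) μ := by
    refine ⟨(Continuous.measurable (by fun_prop)).aestronglyMeasurable, ?_⟩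
    rw [hasFiniteIntegral_iff_norm]
    simpa [edist_dist] using hx₀
  set ν := Measure.map f μ with hν
  have hνu : ν Set.univ = μ Set.univ := by
    rw [hν, Measure.map_apply hfm MeasurableSet.univ, Set.preimage_univ]
  have hνr : ν.real Set.univ = μ.real Set.univ := congrArg ENNReal.toReal hνu
  have hint : ∀ y, Integrable (fun y' => dist y y') ν := by
    intro y
    rw [hν, integrable_map_measure (Continuous.measurable (by fun_prop)).aestronglyMeasurable
      hfm.aemeasurable]
    refine ((integrable_const (dist y (f x₀))).add hX).mono'
      ((Continuous.measurable (by fun_prop)).comp hfm).aestronglyMeasurable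
      (Eventually.of_forall fun x => ?_)
    have h1 := hf.dist_le_mul x₀ x
    rw [NNReal.coe_one, one_mul] at h1
    simp only [Function.comp, Real.norm_eq_abs, abs_of_nonneg dist_nonneg, Pi.add_apply]
    linarith [dist_triangle y (f x₀) (f x)]
  have hsupp : HasSeparableSupport ν := by
    refine ⟨closure (Set.range f), (TopologicalSpace.isSeparable_range hf.continuous).closure, ?_⟩
    rw [hν, Measure.map_apply hfm isClosed_closure.measurableSet.compl]
    convert measure_empty (μ := μ)
    ext x
    simpa using subset_closure (Set.mem_range_self x)
  have : Nonempty T := ⟨c⟩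
  obtain ⟨z, U, hU, hUd, hU₁, hU₂⟩ := exists_median_split hT hint hsupp (hνr ▸ hmr)
  have third : ∀ S : Set T, ν.real Set.univ / 3 ≤ ν.real S → μ Set.univ / 3 ≤ ν S := by
    intro S hS
    rw [← hνu, ← ENNReal.toReal_le_toReal (ENNReal.div_ne_top (measure_ne_top _ _) (by norm_num))
      (measure_ne_top _ _), ENNReal.toReal_div]
    exact hS
  have hball : μ Set.univ - κ ≤ ν (Metric.closedBall z r) :=
    sub_le_measure_closedBall_of_split hf hU hUd (third _ hU₁) (third _ hU₂) hr
  have ho0 : 0 < o := ENNReal.ofReal_pos.1 (bot_le.trans_lt ho)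
  have hr0 : 0 < r := ENNReal.ofReal_pos.1 (bot_le.trans_lt hr)
  have hs0 : 0 < s := ENNReal.ofReal_pos.1 (bot_le.trans_lt hs)
  suffices hcz : dist c z ≤ o + r + s by
    refine cRad_le_ofReal (by positivity) (hball.trans (measure_mono ?_))
    refine Metric.closedBall_subset_closedBall' ?_
    rw [dist_comm z c]
    linarith
  by_contra! hcz
  have hzc : z ≠ c := by
    rintro rfl
    rw [dist_self] at hcz
    linarith
  set h := branchHeight c z
  have hL : LipschitzWith 1 h := lipschitzWith_branchHeight hT c z
  have hhf : LipschitzWith 1 (h ∘ f) := by simpa using hL.comp hf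
  set η := Measure.map (h ∘ f) μ with hη
  have hηmap : η = Measure.map h ν := (Measure.map_map hL.continuous.measurable hfm).symm
  have hηr : η.real Set.univ = μ.real Set.univ := by
    rw [hη, map_measureReal_apply hhf.continuous.measurable MeasurableSet.univ, Set.preimage_univ]
  have hhint : Integrable h ν :=
    (hint c).mono' hL.continuous.measurable.aestronglyMeasurable
      (Eventually.of_forall fun y => (abs_branchHeight c z y).le)
  have hηint : Integrable (fun y => y) η := by
    rw [hηmap, integrable_map_measure (g := fun y => y)
      measurable_id.aestronglyMeasurable hL.continuous.measurable.aemeasurable]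
    exact hhint
  have hcη := isCenterOfMass_real (hηr ▸ hmr) hηint
  set b := (∫ y, y ∂η) / η.real Set.univ
  have hb0 : b ≤ 0 := by
    refine div_nonpos_of_nonpos_of_nonneg ?_ measureReal_nonneg
    rw [hηmap, integral_map (f := fun y => y) hL.continuous.measurable.aemeasurable
      measurable_id.aestronglyMeasurable]
    exact integral_branchHeight_nonpos hT hint hc hzc
  have hA : μ Set.univ - κ ≤ η (Metric.closedBall b o) := by
    refine le_measure_closedBall_of_cRad_lt (lt_of_le_of_lt ?_ ho)
    exact le_iSup₂_of_le (h ∘ f) hhf (le_iSup₂_of_le b hcη le_rfl)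
  rw [hη, Measure.map_apply hhf.continuous.measurable
    Metric.isClosed_closedBall.measurableSet] at hA
  rw [hν, Measure.map_apply hfm Metric.isClosed_closedBall.measurableSet] at hball
  refine hs.not_ge (le_sep (hhf.continuous.measurable Metric.isClosed_closedBall.measurableSet)
    (hfm Metric.isClosed_closedBall.measurableSet) hA hball fun x hx y hy => ?_)
  rw [edist_dist]
  refine ENNReal.ofReal_le_ofReal ?_
  have h1 : |h (f x) - b| ≤ o := hx
  have h2 : dist (f y) z ≤ r := hy
  have h3 := hL.dist_le_mul (f y) z
  have h4 := hhf.dist_le_mul x y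
  have h5 : h z = dist c z := branchHeight_self c z
  rw [NNReal.coe_one, one_mul, Real.dist_eq] at h3 h4
  simp only [Function.comp] at h4
  rw [abs_le] at h1 h3 h4
  linarith

/-- For an mm-space `X` with finite first moment and an `ℝ`-tree `T` such that
every push-forward of `μ_X` under a `1`-Lipschitz map `X → T` has a center of mass, for any
`κ > 0`: `ObsCRad_T(X; -κ) ≤ ObsCRad_ℝ(X; -κ) + 2 Sep(X; m/3, κ/2) + Sep(X; m-κ, m-κ)`. -/
theorem obsCRad_tree_le {X : Type*} [MetricSpace X] [CompleteSpace X]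
    [TopologicalSpace.SeparableSpace X] [MeasurableSpace X] [BorelSpace X]
    (μ : Measure X) [IsFiniteMeasure μ] (hmom : FiniteFirstMoment μ)
    {T : Type*} [MetricSpace T] [MeasurableSpace T] [BorelSpace T] (hT : IsRTree T)
    (hcm : ∀ f : X → T, LipschitzWith 1 f → ∃ c : T, IsCenterOfMass (Measure.map f μ) c)
    (κ : ℝ≥0∞) (hκ0 : 0 < κ) (hκ : κ ≠ ⊤) :
    obsCRad T μ κ
      ≤ obsCRad ℝ μ κ + 2 * sep μ (μ Set.univ / 3) (κ / 2)
          + sep μ (μ Set.univ - κ) (μ Set.univ - κ) := by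
  refine iSup₂_le fun f hf => iSup₂_le fun c hc => ?_
  rcases eq_or_ne (μ Set.univ) 0 with hm0 | hm0
  · refine le_trans (le_of_forall_gt_imp_ge_of_dense fun ρ hρ => ?_) bot_le
    exact sInf_le ⟨hρ, by simp [hm0]⟩
  set O := obsCRad ℝ μ κ
  set R := sep μ (μ Set.univ / 3) (κ / 2)
  set S := sep μ (μ Set.univ - κ) (μ Set.univ - κ)
  rcases eq_or_ne (O + 2 * R + S) ⊤ with htop | htop
  · rw [htop]; exact le_top
  have hSt : S ≠ ⊤ := fun h => htop (by simp [h])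
  have hOt : O ≠ ⊤ := fun h => htop (by simp [h])
  have hRt : R ≠ ⊤ := fun h => htop (by simp [h])
  have lt_ofReal : ∀ {a : ℝ≥0∞} {ε : ℝ}, a ≠ ⊤ → 0 < ε → a < ENNReal.ofReal (a.toReal + ε) :=
    fun ha hε => (ENNReal.lt_ofReal_iff_toReal_lt ha).2 (by linarith)
  refine ENNReal.le_of_forall_pos_le_add fun ε hε _ => ?_
  have hε4 : (0 : ℝ) < ε / 4 := by positivity
  refine (cRad_map_le_ofReal hmom hm0 hT hf hc (lt_ofReal hOt hε4) (lt_ofReal hRt hε4)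
    (lt_ofReal hSt hε4)).trans (le_of_eq ?_)
  have hsum : O.toReal + ε / 4 + 2 * (R.toReal + ε / 4) + (S.toReal + ε / 4)
      = (O + 2 * R + S + ε).toReal := by
    rw [ENNReal.toReal_add htop ENNReal.coe_ne_top, ENNReal.toReal_add (by finiteness) hSt,
      ENNReal.toReal_add hOt (by finiteness), ENNReal.toReal_mul, ENNReal.coe_toReal,
      ENNReal.toReal_ofNat]
    ring
  rw [hsum, ENNReal.ofReal_toReal (by finiteness)]
end
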